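/- arXiv:quant-ph/9907081 — 5 statements merged into one kernel-verified Lean document; each statement's English description precedes it below -/
import Mathlib

section
/- Let f ≥ 0 be a continuous operator monotone function on [0, ∞). Then for every positive semidefinite operator x on a finite-dimensional Hilbert space H and every operator a on H with operator norm at most 1, one has a* f(x) a ≤ f(a* x a) in the Loewner order. -/
open Matrix
open scoped ComplexOrder

/-- `f` is operator monotone of order `k` on the interval `I ⊆ ℝ`: for all self-adjoint
operators `B ≤ C` (Loewner order) on a `k`-dimensional complex Hilbert space with all
eigenvalues in `I`, one has `f(B) ≤ f(C)`, where `f` is applied by functional calculus. -/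
def OperatorMonotoneOfOrder (k : ℕ) (I : Set ℝ) (f : ℝ → ℝ) : Prop :=
  ∀ (B C : Matrix (Fin k) (Fin k) ℂ) (hB : B.IsHermitian) (hC : C.IsHermitian),
    (∀ i, hB.eigenvalues i ∈ I) → (∀ i, hC.eigenvalues i ∈ I) →
    (C - B).PosSemidef → (hC.cfc f - hB.cfc f).PosSemidef

lemma aux_intertwine {m n : ℕ} (C : Matrix (Fin m) (Fin m) ℂ) (Y : Matrix (Fin n) (Fin n) ℂ)
    (hC : C.IsHermitian) (hY : Y.IsHermitian) (W : Matrix (Fin m) (Fin n) ℂ) (s : ℝ)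
    (h : C * W = (s : ℂ) • (W * Y)) (f : ℝ → ℝ) :
    hC.cfc f * W = W * hY.cfc (fun t => f (s * t)) := by
  set U : Matrix (Fin m) (Fin m) ℂ := (hC.eigenvectorUnitary : Matrix (Fin m) (Fin m) ℂ) with hU
  set V : Matrix (Fin n) (Fin n) ℂ := (hY.eigenvectorUnitary : Matrix (Fin n) (Fin n) ℂ) with hV
  have hU1 : Uᴴ * U = 1 := Unitary.coe_star_mul_self hC.eigenvectorUnitary
  have hU2 : U * Uᴴ = 1 := Unitary.coe_mul_star_self hC.eigenvectorUnitary
  have hV1 : Vᴴ * V = 1 := Unitary.coe_star_mul_self hY.eigenvectorUnitary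
  have hV2 : V * Vᴴ = 1 := Unitary.coe_mul_star_self hY.eigenvectorUnitary
  have hCs : C = U * diagonal (fun i => (hC.eigenvalues i : ℂ)) * Uᴴ := hC.spectral_theorem
  have hYs : Y = V * diagonal (fun i => (hY.eigenvalues i : ℂ)) * Vᴴ := hY.spectral_theorem
  have hCf : hC.cfc f = U * diagonal (fun i => (f (hC.eigenvalues i) : ℂ)) * Uᴴ := rfl
  have hYf : hY.cfc (fun t => f (s * t)) =
    V * diagonal (fun i => (f (s * hY.eigenvalues i) : ℂ)) * Vᴴ := rfl
  set M := Uᴴ * W * V with hM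
  have hW : W = U * M * Vᴴ := by
    calc W = (U * Uᴴ) * W * (V * Vᴴ) := by rw [hU2, hV2]; simp
      _ = _ := by simp only [hM, Matrix.mul_assoc]
  have key : diagonal (fun i => (hC.eigenvalues i : ℂ)) * M =
      (s : ℂ) • (M * diagonal (fun i => (hY.eigenvalues i : ℂ))) := by
    have e1 : Uᴴ * (C * W) * V = diagonal (fun i => (hC.eigenvalues i : ℂ)) * M := by
      calc Uᴴ * (C * W) * V = Uᴴ * ((U * diagonal (fun i => (hC.eigenvalues i : ℂ)) * Uᴴ) * W) * V := by
            rw [← hCs]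
        _ = (Uᴴ * U) * diagonal (fun i => (hC.eigenvalues i : ℂ)) * M := by
            simp only [hM, Matrix.mul_assoc]
        _ = _ := by rw [hU1]; simp
    have e2 : Uᴴ * (W * Y) * V = M * diagonal (fun i => (hY.eigenvalues i : ℂ)) := by
      calc Uᴴ * (W * Y) * V = Uᴴ * (W * (V * diagonal (fun i => (hY.eigenvalues i : ℂ)) * Vᴴ)) * V := by
            rw [← hYs]
        _ = M * diagonal (fun i => (hY.eigenvalues i : ℂ)) * (Vᴴ * V) := by
            simp only [hM, Matrix.mul_assoc]
        _ = _ := by rw [hV1]; simp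
    rw [← e1, ← e2, h]; simp
  have key2 : diagonal (fun i => (f (hC.eigenvalues i) : ℂ)) * M =
      M * diagonal (fun i => (f (s * hY.eigenvalues i) : ℂ)) := by
    ext i j
    have := congrFun (congrFun key i) j
    simp only [Matrix.smul_apply, diagonal_mul, mul_diagonal, smul_eq_mul] at this ⊢
    by_cases h0 : M i j = 0
    · simp [h0]
    · have h1 : (hC.eigenvalues i : ℂ) = s * hY.eigenvalues j := by
        apply mul_right_cancel₀ h0; rw [this]; ring
      have h2 : hC.eigenvalues i = s * hY.eigenvalues j := by exact_mod_cast h1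
      rw [h2]; ring
  rw [hCf, hYf]
  calc _ = U * (diagonal (fun i => (f (hC.eigenvalues i) : ℂ)) * M) * Vᴴ := by
        rw [hW]
        calc _ = U * diagonal (fun i => (f (hC.eigenvalues i) : ℂ)) * (Uᴴ * U) * M * Vᴴ := by
              simp only [Matrix.mul_assoc]
          _ = _ := by rw [hU1]; simp [Matrix.mul_assoc]
    _ = U * M * (Vᴴ * V) * diagonal (fun i => (f (s * hY.eigenvalues i) : ℂ)) * Vᴴ := by
        rw [key2, hV1]; simp [Matrix.mul_assoc]
    _ = _ := by
        conv_rhs => rw [hW]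
        simp only [Matrix.mul_assoc]

lemma aux_iso (d : ℕ) : ∃ E F : Matrix (Fin (d + d)) (Fin d) ℂ,
    Eᴴ * E = 1 ∧ Fᴴ * F = 1 ∧ Eᴴ * F = 0 ∧ Fᴴ * E = 0 := by
  refine ⟨(fromRows 1 0).submatrix finSumFinEquiv.symm id,
    (fromRows 0 1).submatrix finSumFinEquiv.symm id, ?_, ?_, ?_, ?_⟩ <;>
  · rw [conjTranspose_submatrix, submatrix_mul_equiv, conjTranspose_fromRows_eq_fromCols_conjTranspose,
      fromCols_mul_fromRows]
    simp

lemma aux_const {n : ℕ} (Y : Matrix (Fin n) (Fin n) ℂ) (hY : Y.IsHermitian) (c : ℝ) :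
    hY.cfc (fun _ => c) = (c : ℂ) • (1 : Matrix (Fin n) (Fin n) ℂ) := by
  set V : Matrix (Fin n) (Fin n) ℂ := (hY.eigenvectorUnitary : Matrix (Fin n) (Fin n) ℂ) with hV
  have hV2 : V * Vᴴ = 1 := Unitary.coe_mul_star_self hY.eigenvectorUnitary
  have hYf : hY.cfc (fun _ => c) = V * diagonal (fun _ => (c : ℂ)) * Vᴴ := rfl
  rw [hYf, ← Matrix.smul_one_eq_diagonal]
  simp [hV2]

lemma aux_delta {d : ℕ} (f : ℝ → ℝ)
    (hf0 : ∀ t : ℝ, 0 ≤ t → 0 ≤ f t)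
    (hfm : ∀ k : ℕ, OperatorMonotoneOfOrder k (Set.Ici 0) f)
    (x a : Matrix (Fin d) (Fin d) ℂ) (hx : x.PosSemidef)
    (ha : ((1 : Matrix (Fin d) (Fin d) ℂ) - aᴴ * a).PosSemidef)
    (hxa : (aᴴ * x * a).IsHermitian) (δ : ℝ) (hδ : 0 < δ) :
    (hxa.cfc (fun t => f ((1 + δ) * t)) - aᴴ * (hx.1.cfc f) * a).PosSemidef := by
  obtain ⟨E, F, hEE, hFF, hEF, hFE⟩ := aux_iso d
  obtain ⟨c, hc⟩ : ∃ c : Matrix (Fin d) (Fin d) ℂ, 1 - aᴴ * a = cᴴ * c := by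
    open scoped MatrixOrder in
    exact CStarAlgebra.nonneg_iff_eq_star_mul_self.1 ha.nonneg
  set X := E * x * Eᴴ with hX
  set W := E * a + F * c with hW
  have hWs : Wᴴ = aᴴ * Eᴴ + cᴴ * Fᴴ := by simp [hW]
  have hEW : Eᴴ * W = a := by
    rw [hW, Matrix.mul_add, ← Matrix.mul_assoc, ← Matrix.mul_assoc, hEE, hEF]; simp
  have hFW : Fᴴ * W = c := by
    rw [hW, Matrix.mul_add, ← Matrix.mul_assoc, ← Matrix.mul_assoc, hFF, hFE]; simp
  have hWW : Wᴴ * W = 1 := by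
    rw [hWs, Matrix.add_mul, Matrix.mul_assoc, Matrix.mul_assoc, hEW, hFW, ← hc]; abel
  have hWE : Wᴴ * E = aᴴ := by rw [← hEW]; simp
  have hXp : X.PosSemidef := hx.mul_mul_conjTranspose_same E
  have hWXW : Wᴴ * X * W = aᴴ * x * a := by
    calc Wᴴ * X * W = (Wᴴ * E) * x * (Eᴴ * W) := by simp only [hX, Matrix.mul_assoc]
      _ = _ := by rw [hWE, hEW]
  set P := W * Wᴴ with hP
  have hPh : Pᴴ = P := by simp [hP]
  have hPW : P * W = W := by rw [hP, Matrix.mul_assoc, hWW, Matrix.mul_one]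
  set Q := 1 - P with hQ
  have hQh : Qᴴ = Q := by simp [hQ, hPh]
  have hQW : Q * W = 0 := by rw [hQ, Matrix.sub_mul, hPW]; simp
  have hd : (δ : ℂ) ≠ 0 := by exact_mod_cast hδ.ne'
  set C := ((1 + δ : ℝ) : ℂ) • (P * X * P) + ((1 + δ⁻¹ : ℝ) : ℂ) • (Q * X * Q) with hCdef
  have hCX : C - X = ((δ⁻¹ : ℝ) : ℂ) • (((δ : ℂ) • P - Q) * X * ((δ : ℂ) • P - Q)ᴴ) := by
    have hXd : X = (P + Q) * X * (P + Q) := by simp [hQ]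
    have : C - X = C - (P + Q) * X * (P + Q) := by rw [← hXd]
    rw [this, hCdef, conjTranspose_sub, conjTranspose_smul, hPh, hQh]
    simp only [Matrix.add_mul, Matrix.mul_add, Matrix.sub_mul, Matrix.mul_sub, Matrix.smul_mul,
      Matrix.mul_smul, smul_sub, smul_smul]
    have hs : star (δ : ℂ) = δ := by simp
    rw [hs]
    have e : ((δ⁻¹ : ℝ) : ℂ) * δ = 1 := by push_cast; field_simp
    have e2 : ((δ⁻¹ : ℝ) : ℂ) * (δ * δ) = δ := by push_cast; field_simp
    simp only [e, e2]
    push_cast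
    module
  have hδi : (0 : ℂ) ≤ ((δ⁻¹ : ℝ) : ℂ) := by
    exact_mod_cast (inv_pos.2 hδ).le
  have hCXp : (C - X).PosSemidef := by
    rw [hCX]; exact (hXp.mul_mul_conjTranspose_same _).smul hδi
  have hCp : C.PosSemidef := by
    have := hCXp.add hXp
    simpa using this
  have hmono := hfm (d + d) X C hXp.1 hCp.1 (fun i => hXp.eigenvalues_nonneg i)
    (fun i => hCp.eigenvalues_nonneg i) hCXp
  have hCW : C * W = ((1 + δ : ℝ) : ℂ) • (W * (aᴴ * x * a)) := by
    rw [hCdef, Matrix.add_mul, Matrix.smul_mul, Matrix.smul_mul, Matrix.mul_assoc _ P W, hPW,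
      Matrix.mul_assoc _ Q W, hQW, ← hWXW, hP]
    simp only [Matrix.mul_assoc]; simp
  have h1 := aux_intertwine C _ hCp.1 hxa W (1 + δ) hCW f
  have h2 := aux_intertwine X x hXp.1 hx.1 E 1 (by
    rw [hX, Matrix.mul_assoc _ Eᴴ E, hEE]; simp) f
  have h3 := aux_intertwine X x hXp.1 hx.1 F 0 (by
    rw [hX, Matrix.mul_assoc _ Eᴴ F, hEF]; simp) f
  simp only [one_mul, zero_mul] at h2 h3
  rw [aux_const] at h3
  have h4 : hXp.1.cfc f * W = E * hx.1.cfc f * a + (f 0 : ℂ) • (F * c) := by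
    rw [hW, Matrix.mul_add, ← Matrix.mul_assoc, ← Matrix.mul_assoc, h2, h3]; simp
  have hWF : Wᴴ * F = cᴴ := by rw [← hFW]; simp
  have h5 : Wᴴ * (hXp.1.cfc f * W) = aᴴ * hx.1.cfc f * a + (f 0 : ℂ) • (cᴴ * c) := by
    rw [h4, Matrix.mul_add, ← hWF, ← hWE]; simp [Matrix.mul_assoc]
  have h6 : Wᴴ * (hCp.1.cfc f * W) = hxa.cfc (fun t => f ((1 + δ) * t)) := by
    rw [h1, ← Matrix.mul_assoc, hWW, Matrix.one_mul]
  have h7 := hmono.conjTranspose_mul_mul_same W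
  rw [Matrix.mul_assoc, Matrix.sub_mul, Matrix.mul_sub, h5, h6] at h7
  have hf00 : (0 : ℂ) ≤ (f 0 : ℂ) := by exact_mod_cast hf0 0 le_rfl
  have h8 := h7.add ((posSemidef_conjTranspose_mul_self c).smul hf00)
  convert h8 using 1
  abel

/-- If `f ≥ 0` is continuous and operator monotone on `[0, ∞)`, then for every positive
semidefinite `x` and every contraction `a` (i.e. `a*a ≤ 1`, equivalently `‖a‖_op ≤ 1`),
one has `a* f(x) a ≤ f(a* x a)` in the Loewner order. -/
theorem cstar_mul_cfc_mul_le {d : ℕ} (f : ℝ → ℝ)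
    (hf0 : ∀ t : ℝ, 0 ≤ t → 0 ≤ f t) (hfc : ContinuousOn f (Set.Ici 0))
    (hfm : ∀ k : ℕ, OperatorMonotoneOfOrder k (Set.Ici 0) f)
    (x a : Matrix (Fin d) (Fin d) ℂ) (hx : x.PosSemidef)
    (ha : ((1 : Matrix (Fin d) (Fin d) ℂ) - aᴴ * a).PosSemidef)
    (hxa : (aᴴ * x * a).IsHermitian) :
    (hxa.cfc f - aᴴ * (hx.1.cfc f) * a).PosSemidef := by
  have hnn : ∀ i, 0 ≤ hxa.eigenvalues i :=
    fun i => (hx.conjTranspose_mul_mul_same a).eigenvalues_nonneg i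
  set V : Matrix (Fin d) (Fin d) ℂ := (hxa.eigenvectorUnitary : Matrix (Fin d) (Fin d) ℂ) with hV
  have hYf : ∀ g : ℝ → ℝ, hxa.cfc g =
    V * diagonal (fun i => (g (hxa.eigenvalues i) : ℂ)) * Vᴴ := fun _ => rfl
  have hlim : Filter.Tendsto (fun δ : ℝ => hxa.cfc (fun t => f ((1 + δ) * t))
      - aᴴ * (hx.1.cfc f) * a) (nhdsWithin 0 (Set.Ioi 0))
      (nhds (hxa.cfc f - aᴴ * (hx.1.cfc f) * a)) := by
    apply Filter.Tendsto.sub_const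
    simp only [hYf]
    have hdiag : Filter.Tendsto
        (fun δ : ℝ => (diagonal (fun i => (f ((1 + δ) * hxa.eigenvalues i) : ℂ)) :
          Matrix (Fin d) (Fin d) ℂ)) (nhdsWithin 0 (Set.Ioi 0))
        (nhds (diagonal (fun i => (f (hxa.eigenvalues i) : ℂ)))) := by
      refine ((continuous_id.matrix_diagonal).tendsto _).comp (tendsto_pi_nhds.2 fun i => ?_)
      refine (Complex.continuous_ofReal.tendsto _).comp ?_
      refine (hfc _ (hnn i)).tendsto.comp (tendsto_nhdsWithin_iff.2 ⟨?_, ?_⟩)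
      · have : Continuous (fun δ : ℝ => (1 + δ) * hxa.eigenvalues i) := by fun_prop
        have h := (this.tendsto 0).mono_left (nhdsWithin_le_nhds (s := Set.Ioi 0))
        simpa using h
      · filter_upwards [self_mem_nhdsWithin] with δ hδ
        have : (0 : ℝ) < δ := hδ
        exact mul_nonneg (by linarith) (hnn i)
    have hc : Continuous (fun D : Matrix (Fin d) (Fin d) ℂ => V * D * Vᴴ) := by fun_prop
    exact (hc.tendsto _).comp hdiag
  have hev : ∀ᶠ δ in nhdsWithin (0 : ℝ) (Set.Ioi 0),
      (hxa.cfc (fun t => f ((1 + δ) * t)) - aᴴ * (hx.1.cfc f) * a).PosSemidef := by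
    filter_upwards [self_mem_nhdsWithin] with δ hδ
    exact aux_delta f hf0 hfm x a hx ha hxa δ hδ
  have hclosed : IsClosed {M : Matrix (Fin d) (Fin d) ℂ | M.PosSemidef} := by
    simp only [posSemidef_iff_dotProduct_mulVec, Set.ofPred_and, Set.ofPred_forall]
    refine IsClosed.inter ?_ (isClosed_iInter fun v => ?_)
    · exact isClosed_eq (by fun_prop) continuous_id
    · exact isClosed_le continuous_const (by fun_prop)
  exact hclosed.mem_of_tendsto hlim hev
end

section
/- Let f ≥ 0 be a continuous operator monotone function on [0, ∞). Then f satisfies Jensen's operator inequality: for all positive semidefinite operators x₁, …, x_n and operators a₁, …, a_n on a finite-dimensional Hilbert space with Σᵢ aᵢ* aᵢ ≤ 1, one has Σᵢ aᵢ* f(xᵢ) aᵢ ≤ f(Σᵢ aᵢ* xᵢ aᵢ). -/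
open Matrix
open scoped ComplexOrder

/-- Spectral decomposition, packaged. -/
lemma jensen_spectral {n : Type*} [Fintype n] [DecidableEq n] {A : Matrix n n ℂ}
    (hA : A.IsHermitian) :
    ∃ U : Matrix n n ℂ, Uᴴ * U = 1 ∧ U * Uᴴ = 1 ∧
      A = U * diagonal (fun i => (hA.eigenvalues i : ℂ)) * Uᴴ ∧
      ∀ f : ℝ → ℝ, hA.cfc f = U * diagonal (fun i => (f (hA.eigenvalues i) : ℂ)) * Uᴴ := by
  refine ⟨hA.eigenvectorUnitary, ?_, ?_, ?_, ?_⟩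
  · rw [← star_eq_conjTranspose]; exact Unitary.coe_star_mul_self _
  · rw [← star_eq_conjTranspose]; exact Unitary.coe_mul_star_self _
  · conv_lhs => rw [hA.spectral_theorem]
    rfl
  · intro f
    rfl

/-- Intertwining with a real diagonal matrix passes to the functional calculus. -/
lemma jensen_intertwine_diag {n p : Type*} [Fintype n] [DecidableEq n] [Fintype p] [DecidableEq p]
    {A : Matrix n n ℂ} (hA : A.IsHermitian) (T : Matrix n p ℂ) (μ : p → ℝ)
    (h : A * T = T * diagonal (fun i => (μ i : ℂ))) (f : ℝ → ℝ) :
    hA.cfc f * T = T * diagonal (fun i => (f (μ i) : ℂ)) := by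
  obtain ⟨U, h1, h2, h3, h4⟩ := jensen_spectral hA
  have key : diagonal (fun i => (hA.eigenvalues i : ℂ)) * (Uᴴ * T)
      = (Uᴴ * T) * diagonal (fun i => (μ i : ℂ)) := by
    calc _ = (Uᴴ * U) * diagonal (fun i => (hA.eigenvalues i : ℂ)) * (Uᴴ * T) := by
            rw [h1, Matrix.one_mul]
      _ = Uᴴ * ((U * diagonal (fun i => (hA.eigenvalues i : ℂ)) * Uᴴ) * T) := by
            simp only [Matrix.mul_assoc]
      _ = _ := by rw [← h3, h, Matrix.mul_assoc]
  have key2 : diagonal (fun i => (f (hA.eigenvalues i) : ℂ)) * (Uᴴ * T)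
      = (Uᴴ * T) * diagonal (fun i => (f (μ i) : ℂ)) := by
    ext i j
    have := congrFun (congrFun key i) j
    rw [diagonal_mul, mul_diagonal] at this ⊢
    by_cases he : hA.eigenvalues i = μ j
    · rw [he, mul_comm]
    · have h0 : ((hA.eigenvalues i : ℂ) - μ j) * (Uᴴ * T) i j = 0 := by linear_combination this
      have h0' : ((hA.eigenvalues i : ℂ) - μ j) ≠ 0 := by
        rw [sub_ne_zero]; exact_mod_cast he
      rw [(mul_eq_zero.mp h0).resolve_left h0']; simp
  rw [h4 f, Matrix.mul_assoc, Matrix.mul_assoc, key2, ← Matrix.mul_assoc, ← Matrix.mul_assoc, h2,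
    Matrix.one_mul]

/-- Intertwining passes to the functional calculus. -/
lemma jensen_intertwine {n p : Type*} [Fintype n] [DecidableEq n] [Fintype p] [DecidableEq p]
    {A : Matrix n n ℂ} (hA : A.IsHermitian) {B : Matrix p p ℂ} (hB : B.IsHermitian)
    (T : Matrix n p ℂ) (h : A * T = T * B) (f : ℝ → ℝ) :
    hA.cfc f * T = T * hB.cfc f := by
  obtain ⟨U, h1, h2, h3, h4⟩ := jensen_spectral hB
  have := jensen_intertwine_diag hA (T * U) hB.eigenvalues (by
    rw [← Matrix.mul_assoc, h]
    conv_lhs => rw [h3]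
    simp only [Matrix.mul_assoc]; rw [h1, Matrix.mul_one]) f
  calc _ = hA.cfc f * (T * (U * Uᴴ)) := by rw [h2, Matrix.mul_one]
    _ = (hA.cfc f * (T * U)) * Uᴴ := by simp only [Matrix.mul_assoc]
    _ = _ := by rw [this, h4]; simp only [Matrix.mul_assoc]

lemma jensen_cfc_isHermitian {n : Type*} [Fintype n] [DecidableEq n] {A : Matrix n n ℂ}
    (hA : A.IsHermitian) (f : ℝ → ℝ) : (hA.cfc f).IsHermitian := by
  obtain ⟨U, h1, h2, h3, h4⟩ := jensen_spectral hA
  rw [h4]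
  apply isHermitian_mul_mul_conjTranspose
  exact isHermitian_diagonal_of_self_adjoint _ (funext fun i => by simp)

/-- Approximate inequality for isometries, in diagonal form. -/
lemma jensen_isometry_eps {k d : ℕ} (f : ℝ → ℝ)
    (hfm : ∀ k : ℕ, OperatorMonotoneOfOrder k (Set.Ici 0) f)
    {Y : Matrix (Fin k) (Fin k) ℂ} (hY : Y.PosSemidef) (V : Matrix (Fin k) (Fin d) ℂ)
    (hV : Vᴴ * V = 1) (μ : Fin d → ℝ)
    (hC : Vᴴ * Y * V = diagonal (fun i => (μ i : ℂ))) (s : ℝ) (hs : 0 < s) :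
    (diagonal (fun i => (f ((1 + s ^ 2) * μ i) : ℂ)) - Vᴴ * hY.1.cfc f * V).PosSemidef := by
  set P := V * Vᴴ with hP
  set Q := 1 - P with hQ
  have hPh : Pᴴ = P := by simp [hP]
  have hQh : Qᴴ = Q := by simp [hQ, hPh]
  have hPV : P * V = V := by rw [hP, Matrix.mul_assoc, hV, Matrix.mul_one]
  have hQV : Q * V = 0 := by rw [hQ, Matrix.sub_mul, hPV, Matrix.one_mul, sub_self]
  set Z := ((1 + s ^ 2 : ℝ) : ℂ) • (P * Y * P) + ((1 + (s⁻¹) ^ 2 : ℝ) : ℂ) • (Q * Y * Q) with hZdef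
  have hZ : Z.PosSemidef := by
    refine .add (.smul ?_ ?_) (.smul ?_ ?_)
    · simpa [hPh] using hY.conjTranspose_mul_mul_same P
    · exact_mod_cast (by positivity : (0:ℝ) ≤ 1 + s ^ 2)
    · simpa [hQh] using hY.conjTranspose_mul_mul_same Q
    · exact_mod_cast (by positivity : (0:ℝ) ≤ 1 + s⁻¹ ^ 2)
  have hZY : (Z - Y).PosSemidef := by
    have := hY.conjTranspose_mul_mul_same ((s : ℂ) • P - ((s⁻¹ : ℝ) : ℂ) • Q)
    convert this using 1
    have hYd : Y = (P + Q) * Y * (P + Q) := by simp [hQ]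
    have hss : (s : ℂ) * ((s⁻¹ : ℝ) : ℂ) = 1 := by
      rw [← Complex.ofReal_mul, mul_inv_cancel₀ hs.ne']; simp
    have hss' : ((s⁻¹ : ℝ) : ℂ) * (s : ℂ) = 1 := by rw [mul_comm, hss]
    conv_lhs => rw [hYd, hZdef]
    simp only [conjTranspose_sub, conjTranspose_smul, hPh, hQh, Complex.star_def,
      Complex.conj_ofReal, Matrix.sub_mul, Matrix.mul_sub, Matrix.add_mul, Matrix.mul_add,
      Matrix.smul_mul, Matrix.mul_smul, smul_smul, smul_sub, hss, hss']
    simp only [Complex.ofReal_add, Complex.ofReal_pow, Complex.ofReal_one]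
    simp only [pow_two, add_smul, one_smul]
    abel
  have hmon := hfm k Y Z hY.1 hZ.1 (fun i => hY.eigenvalues_nonneg i)
    (fun i => hZ.eigenvalues_nonneg i) hZY
  have hZV : Z * V = V * diagonal (fun i => (((1 + s ^ 2) * μ i : ℝ) : ℂ)) := by
    have : diagonal (fun i => (((1 + s ^ 2) * μ i : ℝ) : ℂ))
        = ((1 + s ^ 2 : ℝ) : ℂ) • (Vᴴ * Y * V) := by
      rw [hC, ← diagonal_smul]; congr 1; ext i; simp
    rw [this, hZdef, Matrix.add_mul, smul_mul, smul_mul, Matrix.mul_assoc (P * Y), hPV,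
      Matrix.mul_assoc (Q * Y), hQV, hP]
    simp [Matrix.mul_assoc]
  have hint := jensen_intertwine_diag hZ.1 V _ hZV f
  have := hmon.conjTranspose_mul_mul_same V
  rw [Matrix.mul_sub, Matrix.sub_mul, Matrix.mul_assoc Vᴴ, hint, ← Matrix.mul_assoc, hV,
    Matrix.one_mul] at this
  exact this

/-- The inequality for isometries, in diagonal form. -/
lemma jensen_isometry_diag {k d : ℕ} (f : ℝ → ℝ) (hfc : ContinuousOn f (Set.Ici 0))
    (hfm : ∀ k : ℕ, OperatorMonotoneOfOrder k (Set.Ici 0) f)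
    {Y : Matrix (Fin k) (Fin k) ℂ} (hY : Y.PosSemidef) (V : Matrix (Fin k) (Fin d) ℂ)
    (hV : Vᴴ * V = 1) (μ : Fin d → ℝ) (hμ : ∀ i, 0 ≤ μ i)
    (hC : Vᴴ * Y * V = diagonal (fun i => (μ i : ℂ))) :
    (diagonal (fun i => (f (μ i) : ℂ)) - Vᴴ * hY.1.cfc f * V).PosSemidef := by
  have hH : (diagonal (fun i => (f (μ i) : ℂ)) - Vᴴ * hY.1.cfc f * V).IsHermitian := by
    refine .sub ?_ ?_
    · exact isHermitian_diagonal_of_self_adjoint _ (funext fun i => by simp)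
    · exact isHermitian_conjTranspose_mul_mul _ (jensen_cfc_isHermitian _ _)
  refine .of_dotProduct_mulVec_nonneg hH fun y => ?_
  have hcont : ∀ i, Filter.Tendsto (fun s : ℝ => f ((1 + s ^ 2) * μ i))
      (nhdsWithin 0 (Set.Ioi 0)) (nhds (f (μ i))) := by
    intro i
    have h1 : Filter.Tendsto (fun s : ℝ => (1 + s ^ 2) * μ i) (nhdsWithin 0 (Set.Ioi 0))
        (nhdsWithin (μ i) (Set.Ici 0)) := by
      refine tendsto_nhdsWithin_iff.mpr ⟨?_, Filter.Eventually.of_forall fun s =>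
        mul_nonneg (by positivity) (hμ i)⟩
      have : Filter.Tendsto (fun s : ℝ => (1 + s ^ 2) * μ i) (nhds 0)
          (nhds ((1 + 0 ^ 2) * μ i)) := by
        apply Continuous.tendsto; fun_prop
      simpa using this.mono_left nhdsWithin_le_nhds
    exact (hfc (μ i) (hμ i)).tendsto.comp h1
  have hlim : Filter.Tendsto (fun s : ℝ => star y ⬝ᵥ
      ((diagonal (fun i => (f ((1 + s ^ 2) * μ i) : ℂ)) - Vᴴ * hY.1.cfc f * V) *ᵥ y))
      (nhdsWithin 0 (Set.Ioi 0))
      (nhds (star y ⬝ᵥ ((diagonal (fun i => (f (μ i) : ℂ)) - Vᴴ * hY.1.cfc f * V) *ᵥ y))) := by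
    simp only [Matrix.sub_mulVec, dotProduct_sub]
    refine Filter.Tendsto.sub ?_ tendsto_const_nhds
    simp only [dotProduct, mulVec_diagonal]
    refine tendsto_finsetSum _ fun i _ => ?_
    refine Filter.Tendsto.mul tendsto_const_nhds (Filter.Tendsto.mul ?_ tendsto_const_nhds)
    exact (Complex.continuous_ofReal.tendsto _).comp (hcont i)
  refine ge_of_tendsto hlim ?_
  filter_upwards [self_mem_nhdsWithin] with s hs
  exact (jensen_isometry_eps f hfm hY V hV μ hC s hs).dotProduct_mulVec_nonneg y

/-- The inequality for isometries. -/
lemma jensen_isometry {k d : ℕ} (f : ℝ → ℝ) (hfc : ContinuousOn f (Set.Ici 0))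
    (hfm : ∀ k : ℕ, OperatorMonotoneOfOrder k (Set.Ici 0) f)
    {Y : Matrix (Fin k) (Fin k) ℂ} (hY : Y.PosSemidef) (V : Matrix (Fin k) (Fin d) ℂ)
    (hV : Vᴴ * V = 1) {C : Matrix (Fin d) (Fin d) ℂ} (hCh : C.IsHermitian)
    (hC : Vᴴ * Y * V = C) :
    (hCh.cfc f - Vᴴ * hY.1.cfc f * V).PosSemidef := by
  have hCp : C.PosSemidef := hC ▸ hY.conjTranspose_mul_mul_same V
  obtain ⟨U, h1, h2, h3, h4⟩ := jensen_spectral hCh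
  have := jensen_isometry_diag f hfc hfm hY (V * U)
    (by rw [conjTranspose_mul, Matrix.mul_assoc, ← Matrix.mul_assoc Vᴴ, hV, Matrix.one_mul, h1])
    hCh.eigenvalues (fun i => hCp.eigenvalues_nonneg i) (by
      have : (V * U)ᴴ * Y * (V * U) = Uᴴ * (Vᴴ * Y * V) * U := by
        simp only [conjTranspose_mul, Matrix.mul_assoc]
      rw [this, hC]
      conv_lhs => rw [h3]
      have : ∀ D : Matrix (Fin d) (Fin d) ℂ, Uᴴ * (U * D * Uᴴ) * U = (Uᴴ * U) * D * (Uᴴ * U) := by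
        intro D; simp only [Matrix.mul_assoc]
      rw [this, h1, Matrix.one_mul, Matrix.mul_one])
  have := this.mul_mul_conjTranspose_same U
  convert this using 1
  rw [Matrix.mul_sub, Matrix.sub_mul, ← h4]
  congr 1
  have : ∀ D : Matrix (Fin k) (Fin k) ℂ,
      U * ((V * U)ᴴ * D * (V * U)) * Uᴴ = (U * Uᴴ) * (Vᴴ * D * V) * (U * Uᴴ) := by
    intro D; simp only [conjTranspose_mul, Matrix.mul_assoc]
  rw [this, h2, Matrix.one_mul, Matrix.mul_one]

/-- The inequality for a finite family with `∑ aᵢ* aᵢ = 1`. -/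
lemma jensen_family {ι : Type*} [Fintype ι] [DecidableEq ι] {d : ℕ} (f : ℝ → ℝ)
    (hfc : ContinuousOn f (Set.Ici 0))
    (hfm : ∀ k : ℕ, OperatorMonotoneOfOrder k (Set.Ici 0) f)
    (x a : ι → Matrix (Fin d) (Fin d) ℂ) (hx : ∀ i, (x i).PosSemidef)
    (ha : ∑ i, (a i)ᴴ * a i = 1) {C : Matrix (Fin d) (Fin d) ℂ} (hCh : C.IsHermitian)
    (hC : ∑ i, (a i)ᴴ * x i * a i = C) :
    (hCh.cfc f - ∑ i, (a i)ᴴ * ((hx i).1.cfc f) * a i).PosSemidef := by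
  let e := Fintype.equivFin (ι × Fin d)
  let E : ι → Matrix (Fin (Fintype.card (ι × Fin d))) (Fin d) ℂ :=
    fun i => (1 : Matrix (ι × Fin d) (ι × Fin d) ℂ).submatrix e.symm (fun q => (i, q))
  have hE : ∀ i j, (E i)ᴴ * E j = if i = j then 1 else 0 := by
    intro i j
    have : (E i)ᴴ * E j = (1 : Matrix (ι × Fin d) (ι × Fin d) ℂ).submatrix
        (fun q => (i, q)) (fun q => (j, q)) := by
      simp only [E, conjTranspose_submatrix, conjTranspose_one]
      rw [Matrix.submatrix_mul_equiv, Matrix.one_mul]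
    rw [this]
    ext p q
    by_cases hij : i = j
    · subst hij; simp [Matrix.one_apply]
    · simp [Matrix.one_apply, hij]
  have hEk : ∀ i j (M : Matrix (Fin d) (Fin d) ℂ),
      (E i)ᴴ * (E j * M) = if i = j then M else 0 := by
    intro i j M
    rw [← Matrix.mul_assoc, hE]; split_ifs <;> simp
  set Y := ∑ i, E i * x i * (E i)ᴴ with hYdef
  have hY : Y.PosSemidef :=
    posSemidef_sum _ fun i _ => (hx i).mul_mul_conjTranspose_same (E i)
  set V := ∑ i, E i * a i with hVdef
  have hVE : ∀ g : ι → Matrix (Fin d) (Fin d) ℂ, Vᴴ * ∑ i, E i * g i = ∑ i, (a i)ᴴ * g i := by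
    intro g
    rw [hVdef, conjTranspose_sum, Matrix.sum_mul]
    refine Finset.sum_congr rfl fun i _ => ?_
    rw [conjTranspose_mul, Matrix.mul_assoc, Matrix.mul_sum]
    simp [hEk]
  have hYE : ∀ i, Y * E i = E i * x i := by
    intro i
    rw [hYdef, Matrix.sum_mul]
    simp only [Matrix.mul_assoc, hE]
    rw [Finset.sum_eq_single i] <;> simp +contextual
  have hV : Vᴴ * V = 1 := by rw [← ha, ← hVE]
  have hYV : Y * V = ∑ i, E i * (x i * a i) := by
    rw [hVdef, Matrix.mul_sum]
    simp only [← Matrix.mul_assoc, hYE]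
  have hfYV : hY.1.cfc f * V = ∑ i, E i * ((hx i).1.cfc f * a i) := by
    rw [hVdef, Matrix.mul_sum]
    refine Finset.sum_congr rfl fun i _ => ?_
    rw [← Matrix.mul_assoc, jensen_intertwine hY.1 (hx i).1 (E i) (hYE i) f, Matrix.mul_assoc]
  have := jensen_isometry f hfc hfm hY V hV hCh (by
    rw [Matrix.mul_assoc, hYV, hVE, ← hC]; simp only [Matrix.mul_assoc])
  rw [Matrix.mul_assoc, hfYV, hVE] at this
  simpa only [Matrix.mul_assoc] using this

/-- Jensen's operator inequality: if `f ≥ 0` is continuous and operator monotone on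
`[0, ∞)`, then for positive semidefinite `x₁, …, x_m` and operators `a₁, …, a_m` with
`Σᵢ aᵢ* aᵢ ≤ 1`, one has `Σᵢ aᵢ* f(xᵢ) aᵢ ≤ f(Σᵢ aᵢ* xᵢ aᵢ)`. -/
theorem jensen_operator_inequality {d m : ℕ} (f : ℝ → ℝ)
    (hf0 : ∀ t : ℝ, 0 ≤ t → 0 ≤ f t) (hfc : ContinuousOn f (Set.Ici 0))
    (hfm : ∀ k : ℕ, OperatorMonotoneOfOrder k (Set.Ici 0) f)
    (x a : Fin m → Matrix (Fin d) (Fin d) ℂ) (hx : ∀ i, (x i).PosSemidef)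
    (ha : ((1 : Matrix (Fin d) (Fin d) ℂ) - ∑ i, (a i)ᴴ * a i).PosSemidef)
    (hsum : (∑ i, (a i)ᴴ * x i * a i).IsHermitian) :
    (hsum.cfc f - ∑ i, (a i)ᴴ * ((hx i).1.cfc f) * a i).PosSemidef := by
  obtain ⟨U, h1, h2, h3, h4⟩ := jensen_spectral ha.1
  set B := U * diagonal (fun i => ((Real.sqrt (ha.1.eigenvalues i) : ℝ) : ℂ)) * Uᴴ with hB
  have hBB : Bᴴ * B = 1 - ∑ i, (a i)ᴴ * a i := by
    conv_rhs => rw [h3]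
    have hD : ∀ D : Matrix (Fin d) (Fin d) ℂ,
        (U * D * Uᴴ)ᴴ * (U * D * Uᴴ) = U * Dᴴ * (Uᴴ * U) * D * Uᴴ := by
      intro D; simp only [conjTranspose_mul, conjTranspose_conjTranspose, Matrix.mul_assoc]
    rw [hB, hD, h1, Matrix.mul_one, Matrix.mul_assoc U, diagonal_conjTranspose,
      diagonal_mul_diagonal]
    congr 3
    ext i
    simp only [Pi.star_apply, Complex.star_def, Complex.conj_ofReal]
    rw [← Complex.ofReal_mul, Real.mul_self_sqrt (ha.eigenvalues_nonneg i)]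
  let x' : Option (Fin m) → Matrix (Fin d) (Fin d) ℂ := fun o => o.elim 0 x
  let a' : Option (Fin m) → Matrix (Fin d) (Fin d) ℂ := fun o => o.elim B a
  have hx' : ∀ o, (x' o).PosSemidef := by
    rintro (_ | i)
    · exact .zero
    · exact hx i
  have key := jensen_family f hfc hfm x' a' hx'
    (by rw [Fintype.sum_option]; simp [a', hBB]) hsum
    (by rw [Fintype.sum_option]; simp [x', a'])
  rw [Fintype.sum_option] at key
  have hpos : ((a' none)ᴴ * (hx' none).1.cfc f * a' none).PosSemidef := by
    refine PosSemidef.conjTranspose_mul_mul_same ?_ _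
    obtain ⟨W, w1, w2, w3, w4⟩ := jensen_spectral (hx' none).1
    rw [w4]
    refine PosSemidef.mul_mul_conjTranspose_same (.diagonal fun i => ?_) _
    have := hf0 _ ((hx' none).eigenvalues_nonneg i)
    simpa using this
  have := key.add hpos
  convert this using 1
  simp only [a', x', Option.elim]
  abel
end

section
/- Let f : [0,∞) → [0,∞) be continuous and operator monotone, and let x₁, x₂ be positive semidefinite operators and a₁, a₂ operators with a₁*a₁ + a₂*a₂ ≤ 1. Then f is operator concave in the sense that f(a₁* x₁ a₁ + a₂* x₂ a₂) ≥ a₁* f(x₁) a₁ + a₂* f(x₂) a₂; in particular, for λ ∈ [0,1], f(λx₁ + (1−λ)x₂) ≥ λ f(x₁) + (1−λ) f(x₂). -/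
open Matrix
open scoped ComplexOrder

section Aux

variable {m n : Type*} [Fintype m] [DecidableEq m] [Fintype n] [DecidableEq n]

/-- Unitary diagonalization, packaged together with the functional calculus. -/
lemma aux_diag {A : Matrix n n ℂ} (hA : A.IsHermitian) :
    ∃ U : Matrix n n ℂ, Uᴴ * U = 1 ∧ U * Uᴴ = 1 ∧
      A = U * diagonal (fun i => (hA.eigenvalues i : ℂ)) * Uᴴ ∧
      ∀ f : ℝ → ℝ, hA.cfc f = U * diagonal (fun i => (f (hA.eigenvalues i) : ℂ)) * Uᴴ := by
  refine ⟨hA.eigenvectorUnitary, ?_, ?_, ?_, ?_⟩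
  · exact Unitary.coe_star_mul_self hA.eigenvectorUnitary
  · exact Unitary.coe_mul_star_self hA.eigenvectorUnitary
  · have := hA.spectral_theorem
    rw [Unitary.conjStarAlgAut_apply] at this
    exact this
  · intro f
    rw [IsHermitian.cfc, Unitary.conjStarAlgAut_apply]
    rfl

lemma aux_intertwine_diag {A : Matrix n n ℂ} (hA : A.IsHermitian) (T : Matrix n m ℂ)
    (μ : m → ℝ) (h : A * T = T * diagonal (fun i => (μ i : ℂ))) (f : ℝ → ℝ) :
    hA.cfc f * T = T * diagonal (fun i => (f (μ i) : ℂ)) := by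
  obtain ⟨U, h1, h2, h3, h4⟩ := aux_diag hA
  have key : diagonal (fun i => (hA.eigenvalues i : ℂ)) * (Uᴴ * T)
      = (Uᴴ * T) * diagonal (fun i => (μ i : ℂ)) := by
    rw [Matrix.mul_assoc, ← h]
    nth_rw 2 [h3]
    simp only [← Matrix.mul_assoc, h1, Matrix.one_mul]
  have key2 : diagonal (fun i => (f (hA.eigenvalues i) : ℂ)) * (Uᴴ * T)
      = (Uᴴ * T) * diagonal (fun i => (f (μ i) : ℂ)) := by
    ext i j
    have hij := congrFun (congrFun key i) j
    rw [diagonal_mul, mul_diagonal] at hij ⊢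
    by_cases h0 : (Uᴴ * T) i j = 0
    · simp [h0]
    · have : (hA.eigenvalues i : ℂ) = (μ j : ℂ) := by
        rw [mul_comm] at hij
        exact mul_left_cancel₀ h0 hij
      have h' : hA.eigenvalues i = μ j := by exact_mod_cast this
      rw [h', mul_comm]
  rw [h4, Matrix.mul_assoc, Matrix.mul_assoc, key2, ← Matrix.mul_assoc, ← Matrix.mul_assoc, h2,
    Matrix.one_mul]

lemma aux_intertwine_s12 {A : Matrix n n ℂ} (hA : A.IsHermitian) {X : Matrix m m ℂ}
    (hX : X.IsHermitian) (T : Matrix n m ℂ) (h : A * T = T * X) (f : ℝ → ℝ) :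
    hA.cfc f * T = T * hX.cfc f := by
  obtain ⟨U, h1, h2, h3, h4⟩ := aux_diag hX
  have := aux_intertwine_diag hA (T * U) hX.eigenvalues (by
    rw [← Matrix.mul_assoc, h]
    nth_rw 1 [h3]
    simp only [Matrix.mul_assoc, h1, Matrix.mul_one]) f
  calc hA.cfc f * T = hA.cfc f * (T * U) * Uᴴ := by
        simp only [Matrix.mul_assoc, h2, Matrix.mul_one]
    _ = _ := by rw [this, h4]; simp only [Matrix.mul_assoc]

lemma aux_congr {A B : Matrix n n ℂ} (hA : A.IsHermitian) (hB : B.IsHermitian) (h : A = B)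
    (f : ℝ → ℝ) : hA.cfc f = hB.cfc f := by
  subst h
  rfl

lemma aux_diag_psd (U : Matrix n n ℂ) (μ : n → ℝ) (h : ∀ i, 0 ≤ μ i) :
    (U * diagonal (fun i => (μ i : ℂ)) * Uᴴ).PosSemidef := by
  apply PosSemidef.mul_mul_conjTranspose_same
  apply PosSemidef.diagonal
  intro i
  simpa using h i

lemma aux_cfc_nonneg {A : Matrix n n ℂ} (hA : A.PosSemidef) (f : ℝ → ℝ)
    (hf0 : ∀ t : ℝ, 0 ≤ t → 0 ≤ f t) : (hA.1.cfc f).PosSemidef := by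
  obtain ⟨U, h1, h2, h3, h4⟩ := aux_diag hA.1
  rw [h4]
  exact aux_diag_psd _ _ fun i => hf0 _ (hA.eigenvalues_nonneg i)

lemma aux_cfc_herm {A : Matrix n n ℂ} (hA : A.IsHermitian) (f : ℝ → ℝ) :
    (hA.cfc f).IsHermitian := by
  obtain ⟨U, h1, h2, h3, h4⟩ := aux_diag hA
  rw [h4]
  apply isHermitian_mul_mul_conjTranspose
  rw [isHermitian_diagonal_iff]
  intro i
  simp [IsSelfAdjoint]

lemma aux_sqrt {A : Matrix n n ℂ} (hA : A.PosSemidef) : ∃ B : Matrix n n ℂ, Bᴴ * B = A := by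
  obtain ⟨U, h1, h2, h3, h4⟩ := aux_diag hA.1
  refine ⟨diagonal (fun i => ((Real.sqrt (hA.1.eigenvalues i) : ℝ) : ℂ)) * Uᴴ, ?_⟩
  conv_rhs => rw [h3]
  rw [conjTranspose_mul, conjTranspose_conjTranspose, diagonal_conjTranspose, Matrix.mul_assoc,
    Matrix.mul_assoc]
  congr 1
  rw [← Matrix.mul_assoc, diagonal_mul_diagonal]
  congr 2
  ext i
  simp only [Pi.star_apply, RCLike.star_def, Complex.conj_ofReal]
  rw [← Complex.ofReal_mul, Real.mul_self_sqrt (hA.eigenvalues_nonneg i)]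

lemma aux_bound {A : Matrix n n ℂ} (hA : A.IsHermitian) :
    ∃ c : ℝ, 0 ≤ c ∧ ((c : ℂ) • (1 : Matrix n n ℂ) - A).PosSemidef := by
  obtain ⟨U, h1, h2, h3, h4⟩ := aux_diag hA
  refine ⟨∑ i, |hA.eigenvalues i|, Finset.sum_nonneg fun i _ => abs_nonneg _, ?_⟩
  have := aux_diag_psd U (fun j => (∑ i, |hA.eigenvalues i|) - hA.eigenvalues j) (fun j => by
    have := Finset.single_le_sum (f := fun i => |hA.eigenvalues i|)
      (fun i _ => abs_nonneg _) (Finset.mem_univ j)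
    have h' := le_abs_self (hA.eigenvalues j)
    linarith)
  convert this using 1
  have e : diagonal (fun j => (((∑ i, |hA.eigenvalues i|) - hA.eigenvalues j : ℝ) : ℂ))
      = ((∑ i, |hA.eigenvalues i| : ℝ) : ℂ) • (1 : Matrix n n ℂ)
        - diagonal (fun j => (hA.eigenvalues j : ℂ)) := by
    rw [smul_one_eq_diagonal, diagonal_sub]
    simp only [Complex.ofReal_sub]
  rw [e, Matrix.mul_sub, Matrix.sub_mul, ← h3]
  simp [h2]

/-- Operator monotonicity over an arbitrary finite index type. -/
lemma aux_mono (f : ℝ → ℝ) (hfm : ∀ k : ℕ, OperatorMonotoneOfOrder k (Set.Ici 0) f)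
    {B C : Matrix n n ℂ} (hB : B.PosSemidef) (hC : C.PosSemidef) (h : (C - B).PosSemidef) :
    (hC.1.cfc f - hB.1.cfc f).PosSemidef := by
  let e := Fintype.equivFin n
  let T : Matrix (Fin (Fintype.card n)) n ℂ := (1 : Matrix n n ℂ).submatrix e.symm id
  have hT : Tᴴ * T = 1 := by
    simp only [T, conjTranspose_submatrix, conjTranspose_one]
    rw [submatrix_mul_equiv]
    simp
  have hB' := hB.mul_mul_conjTranspose_same T
  have hC' := hC.mul_mul_conjTranspose_same T
  have hBC := hfm _ (T * B * Tᴴ) (T * C * Tᴴ) hB'.1 hC'.1 hB'.eigenvalues_nonneg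
    hC'.eigenvalues_nonneg (by
      rw [← Matrix.sub_mul, ← Matrix.mul_sub]; exact h.mul_mul_conjTranspose_same T)
  have e1 := aux_intertwine_s12 hB'.1 hB.1 T (by rw [Matrix.mul_assoc, hT, Matrix.mul_one]) f
  have e2 := aux_intertwine_s12 hC'.1 hC.1 T (by rw [Matrix.mul_assoc, hT, Matrix.mul_one]) f
  have := hBC.conjTranspose_mul_mul_same T
  rw [Matrix.mul_assoc, Matrix.sub_mul, e1, e2, ← Matrix.mul_sub, ← Matrix.mul_assoc, hT,
    Matrix.one_mul] at this
  exact this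

/-- For an isometry `W`, `f(W X W*) ≥ W f(X) W*`. -/
lemma aux_isom (f : ℝ → ℝ) (hf0 : ∀ t : ℝ, 0 ≤ t → 0 ≤ f t) {X : Matrix m m ℂ}
    (hX : X.PosSemidef) (W : Matrix n m ℂ) (hW : Wᴴ * W = 1) :
    ((hX.mul_mul_conjTranspose_same W).1.cfc f - W * hX.1.cfc f * Wᴴ).PosSemidef := by
  set hM := hX.mul_mul_conjTranspose_same W
  have e1 := aux_intertwine_s12 hM.1 hX.1 W (by rw [Matrix.mul_assoc, hW, Matrix.mul_one]) f
  have e2 : Wᴴ * hM.1.cfc f = hX.1.cfc f * Wᴴ := by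
    have := congrArg conjTranspose e1
    rw [conjTranspose_mul, conjTranspose_mul, (aux_cfc_herm hM.1 f).eq,
      (aux_cfc_herm hX.1 f).eq] at this
    exact this
  have := (aux_cfc_nonneg hM f hf0).mul_mul_conjTranspose_same (1 - W * Wᴴ)
  convert this using 1
  rw [conjTranspose_sub, conjTranspose_one, conjTranspose_mul, conjTranspose_conjTranspose,
    Matrix.sub_mul, Matrix.one_mul, Matrix.mul_sub, Matrix.mul_one, Matrix.sub_mul,
    ← Matrix.mul_assoc _ W, e1, Matrix.mul_assoc W Wᴴ, e2]
  have : W * (hX.1.cfc f * Wᴴ) * (W * Wᴴ) = W * hX.1.cfc f * (Wᴴ * W) * Wᴴ := by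
    simp only [Matrix.mul_assoc]
  rw [this, hW]
  simp only [Matrix.mul_assoc, Matrix.one_mul, sub_self, sub_zero]

lemma aux_contr (V : Matrix m n ℂ) (hV : (1 - Vᴴ * V).PosSemidef) : (1 - V * Vᴴ).PosSemidef := by
  have : Invertible (1 : Matrix m m ℂ) := invertibleOne
  have : Invertible (1 : Matrix n n ℂ) := invertibleOne
  have h1 := PosDef.fromBlocks₁₁ V (1 : Matrix n n ℂ) (PosDef.one (n := m) (R := ℂ))
  have h2 := PosDef.fromBlocks₂₂ (1 : Matrix m m ℂ) V (PosDef.one (n := n) (R := ℂ))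
  simp only [inv_one, Matrix.mul_one] at h1 h2
  exact h2.1 (h1.2 hV)

lemma aux_eps (f : ℝ → ℝ) (hf0 : ∀ t : ℝ, 0 ≤ t → 0 ≤ f t)
    (hfm : ∀ k : ℕ, OperatorMonotoneOfOrder k (Set.Ici 0) f)
    {X : Matrix m m ℂ} (hX : X.PosSemidef) (V : Matrix m n ℂ) (hV : (1 - Vᴴ * V).PosSemidef)
    (ε : ℝ) (hε : 0 < ε) (hs : (Vᴴ * X * V + (ε : ℂ) • 1).IsHermitian) :
    (hs.cfc f - Vᴴ * hX.1.cfc f * V).PosSemidef := by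
  obtain ⟨B, hB⟩ := aux_sqrt (aux_contr V hV)
  have hεp : ((ε : ℂ) • (1 : Matrix n n ℂ)).PosDef :=
    PosDef.one.smul (by exact_mod_cast hε)
  have hA : (Vᴴ * X * V).PosSemidef := hX.conjTranspose_mul_mul_same V
  have hAε : (Vᴴ * X * V + (ε : ℂ) • 1).PosSemidef := hA.add hεp.posSemidef
  let W : Matrix (n ⊕ m) m ℂ := fromRows Vᴴ B
  have hW : Wᴴ * W = 1 := by
    simp only [W, conjTranspose_fromRows_eq_fromCols_conjTranspose, fromCols_mul_fromRows, hB,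
      conjTranspose_conjTranspose]
    abel
  have hM := hX.mul_mul_conjTranspose_same W
  have eM : W * X * Wᴴ = fromBlocks (Vᴴ * X * V) (Vᴴ * X * Bᴴ) (B * X * V) (B * X * Bᴴ) := by
    simp only [W, conjTranspose_fromRows_eq_fromCols_conjTranspose, conjTranspose_conjTranspose]
    rw [fromRows_mul, fromRows_mul_fromCols]
  let N : Matrix n m ℂ := -(Vᴴ * X * Bᴴ)
  have : Invertible ((ε : ℂ) • (1 : Matrix n n ℂ)) := hεp.isUnit.invertible
  have hQ : (B * X * Bᴴ).PosSemidef := hX.mul_mul_conjTranspose_same B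
  have hR : (B * X * Bᴴ + Nᴴ * ((ε : ℂ) • (1 : Matrix n n ℂ))⁻¹ * N).PosSemidef :=
    hQ.add (hεp.inv.posSemidef.conjTranspose_mul_mul_same N)
  obtain ⟨c, hc0, hc⟩ := aux_bound hR.1
  let D : Matrix (n ⊕ m) (n ⊕ m) ℂ :=
    fromBlocks (Vᴴ * X * V + (ε : ℂ) • 1) 0 0 ((c : ℂ) • 1)
  have hDM : (D - W * X * Wᴴ).PosSemidef := by
    have h := (PosDef.fromBlocks₁₁ N ((c : ℂ) • 1 - B * X * Bᴴ) hεp).2 (by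
      rw [sub_sub]; exact hc)
    have e : D - W * X * Wᴴ = fromBlocks ((ε : ℂ) • 1) N Nᴴ ((c : ℂ) • 1 - B * X * Bᴴ) := by
      rw [eM]
      simp only [D, N]
      rw [sub_eq_add_neg, fromBlocks_neg, fromBlocks_add]
      congr 1
      · abel
      · simp
      · simp [Matrix.mul_assoc, hX.1.eq]
    rw [e]
    exact h
  have hD : D.PosSemidef := by
    have := hDM.add hM
    rwa [sub_add_cancel] at this
  have h1 := aux_mono f hfm hM hD hDM
  have h2 := aux_isom f hf0 hX W hW
  let T : Matrix (n ⊕ m) n ℂ := fromRows 1 0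
  have hT : Tᴴ * T = 1 := by
    simp [T, conjTranspose_fromRows_eq_fromCols_conjTranspose, fromCols_mul_fromRows]
  have hTW : Tᴴ * W = Vᴴ := by
    simp [T, W, conjTranspose_fromRows_eq_fromCols_conjTranspose, fromCols_mul_fromRows]
  have hWT : Wᴴ * T = V := by
    have := congrArg conjTranspose hTW
    simpa using this
  have h3 := aux_intertwine_s12 hD.1 hs T (by
    simp only [T, D]
    rw [← fromRows_fromCols_eq_fromBlocks, fromRows_mul, fromRows_mul]
    simp [fromCols_mul_fromRows]) f
  have h4 := (h1.add h2).conjTranspose_mul_mul_same T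
  rw [sub_add_sub_cancel, Matrix.mul_sub, Matrix.sub_mul, Matrix.mul_assoc, h3,
    ← Matrix.mul_assoc, hT, Matrix.one_mul] at h4
  convert h4 using 2
  rw [← Matrix.mul_assoc, ← Matrix.mul_assoc, hTW, Matrix.mul_assoc _ Wᴴ T, hWT]

open Filter Topology in
lemma aux_main (f : ℝ → ℝ) (hf0 : ∀ t : ℝ, 0 ≤ t → 0 ≤ f t) (hfc : ContinuousOn f (Set.Ici 0))
    (hfm : ∀ k : ℕ, OperatorMonotoneOfOrder k (Set.Ici 0) f)
    {X : Matrix m m ℂ} (hX : X.PosSemidef) (V : Matrix m n ℂ) (hV : (1 - Vᴴ * V).PosSemidef)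
    (hs : (Vᴴ * X * V).IsHermitian) :
    (hs.cfc f - Vᴴ * hX.1.cfc f * V).PosSemidef := by
  have hA : (Vᴴ * X * V).PosSemidef := hX.conjTranspose_mul_mul_same V
  obtain ⟨U, h1, h2, h3, h4⟩ := aux_diag hs
  have key : ∀ ε : ℝ, 0 < ε →
      (U * diagonal (fun i => (f (hs.eigenvalues i + ε) : ℂ)) * Uᴴ
        - Vᴴ * hX.1.cfc f * V).PosSemidef := by
    intro ε hε
    have hh : (Vᴴ * X * V + (ε : ℂ) • 1).IsHermitian := by
      refine hs.add ?_
      simp [IsHermitian, conjTranspose_smul]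
    have e := aux_eps f hf0 hfm hX V hV ε hε hh
    have i := aux_intertwine_diag hh U (fun i => hs.eigenvalues i + ε) (by
      have : diagonal (fun i => ((hs.eigenvalues i + ε : ℝ) : ℂ))
          = diagonal (fun i => (hs.eigenvalues i : ℂ)) + (ε : ℂ) • (1 : Matrix n n ℂ) := by
        rw [smul_one_eq_diagonal, diagonal_add]
        simp only [Complex.ofReal_add]
      rw [this, Matrix.add_mul, Matrix.mul_add]
      nth_rw 1 [h3]
      simp [Matrix.mul_assoc, h1]) f
    rw [← i, Matrix.mul_assoc, h2, Matrix.mul_one]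
    exact e
  rw [h4]
  have hlim : Tendsto (fun ε : ℝ => U * diagonal (fun i => (f (hs.eigenvalues i + ε) : ℂ)) * Uᴴ
        - Vᴴ * hX.1.cfc f * V) (𝓝[>] 0)
      (𝓝 (U * diagonal (fun i => (f (hs.eigenvalues i) : ℂ)) * Uᴴ - Vᴴ * hX.1.cfc f * V)) := by
    have hF : Continuous (fun g : n → ℝ => U * diagonal (fun i => (g i : ℂ)) * Uᴴ
        - Vᴴ * hX.1.cfc f * V) := by fun_prop
    refine (hF.tendsto (fun i => f (hs.eigenvalues i))).comp
      (f := fun ε : ℝ => fun i => f (hs.eigenvalues i + ε)) ?_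
    rw [tendsto_pi_nhds]
    intro i
    have hi := hA.eigenvalues_nonneg i
    refine (hfc _ hi).tendsto.comp (tendsto_nhdsWithin_iff.2 ⟨?_, ?_⟩)
    · have : Tendsto (fun ε : ℝ => hs.eigenvalues i + ε) (𝓝 0) (𝓝 (hs.eigenvalues i + 0)) :=
        (continuous_const.add continuous_id).tendsto 0
      rw [add_zero] at this
      exact this.mono_left nhdsWithin_le_nhds
    · filter_upwards [self_mem_nhdsWithin] with ε hε
      exact add_nonneg hi (le_of_lt hε)
  refine PosSemidef.of_dotProduct_mulVec_nonneg ?_ fun x => ?_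
  · rw [← h4]
    exact (aux_cfc_herm _ f).sub (isHermitian_conjTranspose_mul_mul _ (aux_cfc_herm _ f))
  · have hG : Continuous (fun M : Matrix n n ℂ => star x ⬝ᵥ (M *ᵥ x)) := by fun_prop
    refine ge_of_tendsto ((hG.tendsto _).comp hlim) ?_
    filter_upwards [self_mem_nhdsWithin] with ε hε
    exact (key ε hε).dotProduct_mulVec_nonneg x

lemma aux_two {x₁ x₂ : Matrix n n ℂ} (f : ℝ → ℝ)
    (hf0 : ∀ t : ℝ, 0 ≤ t → 0 ≤ f t) (hfc : ContinuousOn f (Set.Ici 0))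
    (hfm : ∀ k : ℕ, OperatorMonotoneOfOrder k (Set.Ici 0) f) (a₁ a₂ : Matrix n n ℂ)
    (hx₁ : x₁.PosSemidef) (hx₂ : x₂.PosSemidef)
    (ha : ((1 : Matrix n n ℂ) - (a₁ᴴ * a₁ + a₂ᴴ * a₂)).PosSemidef)
    (hs : (a₁ᴴ * x₁ * a₁ + a₂ᴴ * x₂ * a₂).IsHermitian) :
    (hs.cfc f - (a₁ᴴ * (hx₁.1.cfc f) * a₁ + a₂ᴴ * (hx₂.1.cfc f) * a₂)).PosSemidef := by
  let X : Matrix (n ⊕ n) (n ⊕ n) ℂ := fromBlocks x₁ 0 0 x₂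
  let V : Matrix (n ⊕ n) n ℂ := fromRows a₁ a₂
  let T₁ : Matrix (n ⊕ n) n ℂ := fromRows 1 0
  let T₂ : Matrix (n ⊕ n) n ℂ := fromRows 0 1
  have eX : X = T₁ * x₁ * T₁ᴴ + T₂ * x₂ * T₂ᴴ := by
    simp only [X, T₁, T₂, conjTranspose_fromRows_eq_fromCols_conjTranspose]
    rw [fromRows_mul, fromRows_mul_fromCols, fromRows_mul, fromRows_mul_fromCols, fromBlocks_add]
    simp
  have hX : X.PosSemidef := by
    rw [eX]
    exact (hx₁.mul_mul_conjTranspose_same T₁).add (hx₂.mul_mul_conjTranspose_same T₂)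
  have eV : V = T₁ * a₁ + T₂ * a₂ := by
    ext i j
    rcases i with i | i <;> simp [V, T₁, T₂, fromRows_mul]
  have i₁ := aux_intertwine_s12 hX.1 hx₁.1 T₁ (by
    simp only [T₁, X]
    rw [← fromRows_fromCols_eq_fromBlocks, fromRows_mul, fromRows_mul]
    simp [fromCols_mul_fromRows]) f
  have i₂ := aux_intertwine_s12 hX.1 hx₂.1 T₂ (by
    simp only [T₂, X]
    rw [← fromRows_fromCols_eq_fromBlocks, fromRows_mul, fromRows_mul]
    simp [fromCols_mul_fromRows]) f
  have v₁ : Vᴴ * T₁ = a₁ᴴ := by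
    simp [V, T₁, conjTranspose_fromRows_eq_fromCols_conjTranspose, fromCols_mul_fromRows]
  have v₂ : Vᴴ * T₂ = a₂ᴴ := by
    simp [V, T₂, conjTranspose_fromRows_eq_fromCols_conjTranspose, fromCols_mul_fromRows]
  have hV : (1 - Vᴴ * V).PosSemidef := by
    convert ha using 2
    simp [V, conjTranspose_fromRows_eq_fromCols_conjTranspose, fromCols_mul_fromRows]
  have eA : Vᴴ * X * V = a₁ᴴ * x₁ * a₁ + a₂ᴴ * x₂ * a₂ := by
    have v₁' := congrArg conjTranspose v₁
    have v₂' := congrArg conjTranspose v₂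
    simp only [conjTranspose_mul, conjTranspose_conjTranspose] at v₁' v₂'
    rw [eX, Matrix.mul_add, Matrix.add_mul, ← Matrix.mul_assoc, ← Matrix.mul_assoc, v₁,
      ← Matrix.mul_assoc, ← Matrix.mul_assoc, v₂, Matrix.mul_assoc _ T₁ᴴ, Matrix.mul_assoc _ T₂ᴴ,
      v₁', v₂']
  have eF : Vᴴ * hX.1.cfc f * V = a₁ᴴ * (hx₁.1.cfc f) * a₁ + a₂ᴴ * (hx₂.1.cfc f) * a₂ := by
    nth_rw 2 [eV]
    rw [Matrix.mul_assoc, Matrix.mul_add, ← Matrix.mul_assoc _ T₁, ← Matrix.mul_assoc _ T₂, i₁, i₂,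
      Matrix.mul_add, Matrix.mul_assoc T₁, Matrix.mul_assoc T₂, ← Matrix.mul_assoc _ T₁,
      ← Matrix.mul_assoc _ T₂, v₁, v₂, ← Matrix.mul_assoc, ← Matrix.mul_assoc]
  have hs' : (Vᴴ * X * V).IsHermitian := by rw [eA]; exact hs
  have := aux_main f hf0 hfc hfm hX V hV hs'
  rw [eF] at this
  have e : hs'.cfc f = hs.cfc f := aux_congr _ _ eA f
  rw [e] at this
  exact this

end Aux

/-- A nonnegative continuous operator monotone function `f` on `[0, ∞)` is operator
concave: `f(a₁* x₁ a₁ + a₂* x₂ a₂) ≥ a₁* f(x₁) a₁ + a₂* f(x₂) a₂` whenever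
`a₁*a₁ + a₂*a₂ ≤ 1`; in particular `f(λx₁ + (1-λ)x₂) ≥ λ f(x₁) + (1-λ) f(x₂)`
for `λ ∈ [0,1]`. -/
theorem operatorMonotone_operatorConcave {d : ℕ} (f : ℝ → ℝ)
    (hf0 : ∀ t : ℝ, 0 ≤ t → 0 ≤ f t) (hfc : ContinuousOn f (Set.Ici 0))
    (hfm : ∀ k : ℕ, OperatorMonotoneOfOrder k (Set.Ici 0) f) :
    (∀ (x₁ x₂ a₁ a₂ : Matrix (Fin d) (Fin d) ℂ)
      (hx₁ : x₁.PosSemidef) (hx₂ : x₂.PosSemidef),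
      ((1 : Matrix (Fin d) (Fin d) ℂ) - (a₁ᴴ * a₁ + a₂ᴴ * a₂)).PosSemidef →
      ∀ (hs : (a₁ᴴ * x₁ * a₁ + a₂ᴴ * x₂ * a₂).IsHermitian),
        (hs.cfc f - (a₁ᴴ * (hx₁.1.cfc f) * a₁ + a₂ᴴ * (hx₂.1.cfc f) * a₂)).PosSemidef) ∧
    (∀ (l : ℝ), 0 ≤ l → l ≤ 1 →
      ∀ (x₁ x₂ : Matrix (Fin d) (Fin d) ℂ)
        (hx₁ : x₁.PosSemidef) (hx₂ : x₂.PosSemidef)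
        (hs : (l • x₁ + (1 - l) • x₂).IsHermitian),
        (hs.cfc f - (l • (hx₁.1.cfc f) + (1 - l) • (hx₂.1.cfc f))).PosSemidef) := by
  refine ⟨fun x₁ x₂ a₁ a₂ hx₁ hx₂ ha hs => aux_two f hf0 hfc hfm a₁ a₂ hx₁ hx₂ ha hs, ?_⟩
  intro l hl0 hl1 x₁ x₂ hx₁ hx₂ hs
  have e : ∀ (r : ℝ), 0 ≤ r → ∀ y : Matrix (Fin d) (Fin d) ℂ,
      (((Real.sqrt r : ℝ) : ℂ) • (1 : Matrix (Fin d) (Fin d) ℂ))ᴴ * y *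
        (((Real.sqrt r : ℝ) : ℂ) • (1 : Matrix (Fin d) (Fin d) ℂ)) = r • y := by
    intro r hr y
    rw [conjTranspose_smul, conjTranspose_one]
    simp only [RCLike.star_def, Complex.conj_ofReal, Matrix.smul_mul, Matrix.one_mul,
      Matrix.mul_smul, Matrix.mul_one, smul_smul]
    rw [← Complex.ofReal_mul, Real.mul_self_sqrt hr]
    rfl
  have hl1' : 0 ≤ 1 - l := by linarith
  have ha := e l hl0 1
  have hb := e (1 - l) hl1' 1
  rw [Matrix.mul_one] at ha hb
  have h := aux_two (x₁ := x₁) (x₂ := x₂) f hf0 hfc hfm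
    (((Real.sqrt l : ℝ) : ℂ) • 1) (((Real.sqrt (1 - l) : ℝ) : ℂ) • 1) hx₁ hx₂ (by
      rw [ha, hb, ← add_smul]
      simpa using PosSemidef.zero) (by rw [e l hl0, e _ hl1']; exact hs)
  rw [e l hl0 (hx₁.1.cfc f), e _ hl1' (hx₂.1.cfc f)] at h
  rw [aux_congr _ hs (by rw [e l hl0, e _ hl1']) f] at h
  exact h
end

section
/- Let β : A₁ → A₂ be a unital Schwarz map between finite-dimensional C*-algebras (β(x*x) ≥ β(x)*β(x) for all x), let S₁, T₁ ∈ A₁⁺ and S₂, T₂ ∈ A₂⁺ with T₁, T₂ invertible, and suppose tr(S₂ β(a)) ≤ tr(S₁ a) and tr(T₂ β(a)) ≤ tr(T₁ a) for all a ∈ A₁⁺. Then for all 0 ≤ t ≤ 1 and all x ∈ A₁: tr(β(x)* S₂^t β(x) T₂^{1−t}) ≤ tr(x* S₁^t x T₁^{1−t}). -/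
open Matrix
open scoped ComplexOrder

/-- coordinates of `x` in the two eigenbases -/
noncomputable def uCo {n : ℕ} {S T : Matrix (Fin n) (Fin n) ℂ} (hS : S.IsHermitian)
    (hT : T.IsHermitian) (x : Matrix (Fin n) (Fin n) ℂ) : Matrix (Fin n) (Fin n) ℂ :=
  star (hS.eigenvectorUnitary : Matrix (Fin n) (Fin n) ℂ) * x *
    (hT.eigenvectorUnitary : Matrix (Fin n) (Fin n) ℂ)

/-- weighted quadratic form -/
noncomputable def uQ {n : ℕ} {S T : Matrix (Fin n) (Fin n) ℂ} (hS : S.IsHermitian)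
    (hT : T.IsHermitian) (k : ℝ → ℝ → ℝ) (x : Matrix (Fin n) (Fin n) ℂ) : ℝ :=
  ∑ i, ∑ j, k (hS.eigenvalues i) (hT.eigenvalues j) * Complex.normSq (uCo hS hT x i j)

lemma u_trace {n : ℕ} {S T : Matrix (Fin n) (Fin n) ℂ} (hS : S.IsHermitian)
    (hT : T.IsHermitian) (f g : ℝ → ℝ) (x : Matrix (Fin n) (Fin n) ℂ) :
    (star x * hS.cfc f * x * hT.cfc g).trace =
      ((uQ hS hT (fun s t => f s * g t) x : ℝ) : ℂ) := by
  have h : (star x * hS.cfc f * x * hT.cfc g).trace =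
      (star (uCo hS hT x) * diagonal (RCLike.ofReal ∘ f ∘ hS.eigenvalues) * uCo hS hT x *
        diagonal (RCLike.ofReal ∘ g ∘ hT.eigenvalues)).trace := by
    rw [IsHermitian.cfc, IsHermitian.cfc, Unitary.conjStarAlgAut_apply,
      Unitary.conjStarAlgAut_apply, uCo]
    simp only [star_mul, star_star, ← mul_assoc]
    rw [Matrix.trace_mul_comm]
    simp only [← mul_assoc]
  rw [h, Matrix.trace]
  simp only [diag_apply, mul_diagonal, uQ]
  simp only [Matrix.mul_apply (M := star (uCo hS hT x) * _), mul_diagonal]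
  push_cast
  rw [Finset.sum_comm]
  refine Finset.sum_congr rfl fun j _ => ?_
  rw [Finset.sum_mul]
  refine Finset.sum_congr rfl fun i _ => ?_
  rw [Complex.normSq_eq_conj_mul_self]
  simp [star_apply]
  ring

lemma u_cfc_id {n : ℕ} {S : Matrix (Fin n) (Fin n) ℂ} (hS : S.IsHermitian) :
    hS.cfc (fun r => r) = S := by
  conv_rhs => rw [hS.spectral_theorem]
  rfl

lemma u_cfc_one {n : ℕ} {S : Matrix (Fin n) (Fin n) ℂ} (hS : S.IsHermitian) :
    hS.cfc (fun _ => 1) = 1 := by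
  rw [← hS.cfc_eq]; exact cfc_const_one ℝ S

lemma u_inj {n : ℕ} {S T : Matrix (Fin n) (Fin n) ℂ} (hS : S.IsHermitian)
    (hT : T.IsHermitian) (x : Matrix (Fin n) (Fin n) ℂ) (h : uCo hS hT x = 0) : x = 0 := by
  have h2 := congrArg (fun z => (hS.eigenvectorUnitary : Matrix (Fin n) (Fin n) ℂ) * z *
    star (hT.eigenvectorUnitary : Matrix (Fin n) (Fin n) ℂ)) h
  simp only [uCo, mul_zero, zero_mul] at h2
  have e1 : (hS.eigenvectorUnitary : Matrix (Fin n) (Fin n) ℂ) *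
    star (hS.eigenvectorUnitary : Matrix (Fin n) (Fin n) ℂ) = 1 :=
    Unitary.coe_mul_star_self hS.eigenvectorUnitary
  have e2 : (hT.eigenvectorUnitary : Matrix (Fin n) (Fin n) ℂ) *
    star (hT.eigenvectorUnitary : Matrix (Fin n) (Fin n) ℂ) = 1 :=
    Unitary.coe_mul_star_self hT.eigenvectorUnitary
  simp only [mul_assoc, e2, mul_one] at h2
  rwa [← mul_assoc, e1, one_mul] at h2

lemma u_left {n : ℕ} {S T : Matrix (Fin n) (Fin n) ℂ} (hS : S.IsHermitian)
    (hT : T.IsHermitian) (x : Matrix (Fin n) (Fin n) ℂ) (i j : Fin n) :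
    uCo hS hT (S * x) i j = hS.eigenvalues i * uCo hS hT x i j := by
  have : uCo hS hT (S * x) = diagonal (RCLike.ofReal ∘ hS.eigenvalues) * uCo hS hT x := by
    have e0 := hS.spectral_theorem
    rw [Unitary.conjStarAlgAut_apply] at e0
    have e2 := congrArg (fun z => uCo hS hT (z * x)) e0
    rw [e2, uCo]
    have e1 : star (hS.eigenvectorUnitary : Matrix (Fin n) (Fin n) ℂ) *
        (hS.eigenvectorUnitary : Matrix (Fin n) (Fin n) ℂ) = 1 :=
      Unitary.coe_star_mul_self hS.eigenvectorUnitary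
    rw [uCo]
    simp only [← mul_assoc]
    rw [e1, one_mul]
  rw [this, diagonal_mul]; rfl

lemma u_right {n : ℕ} {S T : Matrix (Fin n) (Fin n) ℂ} (hS : S.IsHermitian)
    (hT : T.IsHermitian) (x : Matrix (Fin n) (Fin n) ℂ) (i j : Fin n) :
    uCo hS hT (x * T) i j = hT.eigenvalues j * uCo hS hT x i j := by
  have : uCo hS hT (x * T) = uCo hS hT x * diagonal (RCLike.ofReal ∘ hT.eigenvalues) := by
    have e0 := hT.spectral_theorem
    rw [Unitary.conjStarAlgAut_apply] at e0
    have e2 := congrArg (fun z => uCo hS hT (x * z)) e0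
    rw [e2, uCo]
    have e1 : star (hT.eigenvectorUnitary : Matrix (Fin n) (Fin n) ℂ) *
        (hT.eigenvectorUnitary : Matrix (Fin n) (Fin n) ℂ) = 1 :=
      Unitary.coe_star_mul_self hT.eigenvectorUnitary
    rw [uCo]
    simp only [mul_assoc]
    rw [e1, mul_one]
  rw [this, mul_diagonal, mul_comm]; rfl

lemma u_add {n : ℕ} {S T : Matrix (Fin n) (Fin n) ℂ} (hS : S.IsHermitian)
    (hT : T.IsHermitian) (x y : Matrix (Fin n) (Fin n) ℂ) :
    uCo hS hT (x + y) = uCo hS hT x + uCo hS hT y := by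
  simp [uCo, mul_add, add_mul]

lemma u_smul {n : ℕ} {S T : Matrix (Fin n) (Fin n) ℂ} (hS : S.IsHermitian)
    (hT : T.IsHermitian) (c : ℂ) (y : Matrix (Fin n) (Fin n) ℂ) :
    uCo hS hT (c • y) = c • uCo hS hT y := by
  simp [uCo]

lemma u_trace_nonneg {n : ℕ} {S P : Matrix (Fin n) (Fin n) ℂ} (hS : S.PosSemidef)
    (hP : P.PosSemidef) : 0 ≤ (S * P).trace := by
  have hB : ∃ B : Matrix (Fin n) (Fin n) ℂ, S = star B * B := by
    open scoped MatrixOrder in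
    exact CStarAlgebra.nonneg_iff_eq_star_mul_self.mp hS.nonneg
  obtain ⟨B, rfl⟩ := hB
  rw [mul_assoc, Matrix.trace_mul_comm]
  exact (hP.mul_mul_conjTranspose_same B).trace_nonneg

/-- scalar: parallel sum is below any decomposition -/
lemma u_scalar {s t l : ℝ} (hs : 0 ≤ s) (ht : 0 < t) (hl : 0 < l) (y z : ℂ) :
    l * (s * t / (s + l * t)) * Complex.normSq (y + z) ≤
      s * Complex.normSq y + l * (t * Complex.normSq z) := by
  have hp : 0 < s + l * t := by positivity
  rw [mul_div_assoc', div_mul_eq_mul_div, div_le_iff₀ hp]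
  simp only [Complex.normSq_apply, Complex.add_re, Complex.add_im]
  nlinarith [sq_nonneg (s * y.re - l * t * z.re), sq_nonneg (s * y.im - l * t * z.im)]

lemma u_decomp_le {n : ℕ} {S T : Matrix (Fin n) (Fin n) ℂ} (hS : S.PosSemidef)
    (hT : T.PosDef) {l : ℝ} (hl : 0 < l) (y z : Matrix (Fin n) (Fin n) ℂ) :
    l * uQ hS.1 hT.1 (fun s t => s * t / (s + l * t)) (y + z) ≤
      uQ hS.1 hT.1 (fun s _ => s * 1) y + l * uQ hS.1 hT.1 (fun _ t => 1 * t) z := by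
  simp only [uQ, Finset.mul_sum, ← Finset.sum_add_distrib]
  refine Finset.sum_le_sum fun i _ => Finset.sum_le_sum fun j _ => ?_
  rw [u_add, Matrix.add_apply]
  have := u_scalar (hS.eigenvalues_nonneg i) (hT.eigenvalues_pos j) hl
    (uCo hS.1 hT.1 y i j) (uCo hS.1 hT.1 z i j)
  simpa [mul_assoc] using this

lemma u_scalar_eq {s t l : ℝ} (hs : 0 ≤ s) (ht : 0 < t) (hl : 0 < l) (y z : ℂ)
    (h : s * y = l * (t * z)) :
    l * (s * t / (s + l * t)) * Complex.normSq (y + z) =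
      s * Complex.normSq y + l * (t * Complex.normSq z) := by
  have hp : 0 < s + l * t := by positivity
  have h1 : s * y.re = l * (t * z.re) := by simpa using congrArg Complex.re h
  have h2 : s * y.im = l * (t * z.im) := by simpa using congrArg Complex.im h
  rw [mul_div_assoc', div_mul_eq_mul_div, div_eq_iff hp.ne']
  simp only [Complex.normSq_apply, Complex.add_re, Complex.add_im]
  linear_combination (-(s * y.re - l * t * z.re)) * h1 - (s * y.im - l * t * z.im) * h2

lemma u_decomp_eq {n : ℕ} (A : StarSubalgebra ℂ (Matrix (Fin n) (Fin n) ℂ)) (S T : A)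
    (hS : (S : Matrix (Fin n) (Fin n) ℂ).PosSemidef)
    (hT : (T : Matrix (Fin n) (Fin n) ℂ).PosDef) {l : ℝ} (hl : 0 < l) (x : A) :
    ∃ y z : A, x = y + z ∧
    l * uQ hS.1 hT.1 (fun s t => s * t / (s + l * t)) x =
      uQ hS.1 hT.1 (fun s _ => s * 1) y + l * uQ hS.1 hT.1 (fun _ t => 1 * t) z := by
  let F : A →ₗ[ℂ] A := LinearMap.mulLeft ℂ S + (l : ℂ) • LinearMap.mulRight ℂ T
  have hF : ∀ y, F y = S * y + (l : ℂ) • (y * T) := fun y => rfl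
  have : FiniteDimensional ℂ A := FiniteDimensional.finiteDimensional_submodule
    (Subalgebra.toSubmodule A.toSubalgebra)
  have hinj : Function.Injective F := by
    rw [← LinearMap.ker_eq_bot, LinearMap.ker_eq_bot']
    intro y hy
    rw [hF] at hy
    apply Subtype.ext
    apply u_inj hS.1 hT.1
    ext i j
    have h0 := congrArg (fun a : A => uCo hS.1 hT.1 (a : Matrix (Fin n) (Fin n) ℂ) i j) hy
    have hz : uCo hS.1 hT.1 0 i j = 0 := by simp [uCo]
    simp only [AddMemClass.coe_add, MulMemClass.coe_mul,
      SetLike.val_smul, ZeroMemClass.coe_zero, u_add, u_smul, Matrix.add_apply,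
      Matrix.smul_apply, u_left, u_right, smul_eq_mul, hz] at h0
    have hp : 0 < hS.1.eigenvalues i + l * hT.1.eigenvalues j := by
      have := hS.eigenvalues_nonneg i
      have := hT.eigenvalues_pos j
      positivity
    have h1 : ((hS.1.eigenvalues i + l * hT.1.eigenvalues j : ℝ) : ℂ) *
        uCo hS.1 hT.1 (y : Matrix (Fin n) (Fin n) ℂ) i j = 0 := by
      push_cast; linear_combination h0
    rcases mul_eq_zero.mp h1 with h | h
    · exact absurd (by exact_mod_cast h) hp.ne'
    · simpa using h
  obtain ⟨y, hy⟩ := (LinearMap.injective_iff_surjective.mp hinj) ((l : ℂ) • (x * T))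
  refine ⟨y, x - y, by abel, ?_⟩
  obtain ⟨z, rfl⟩ : ∃ z, x = y + z := ⟨x - y, by abel⟩
  rw [add_sub_cancel_left]
  rw [hF, add_mul, smul_add, add_comm] at hy
  have hy := add_left_cancel hy
  simp only [uQ, Finset.mul_sum, ← Finset.sum_add_distrib]
  refine Finset.sum_congr rfl fun i _ => Finset.sum_congr rfl fun j _ => ?_
  have h0 := congrArg (fun a : A => uCo hS.1 hT.1 (a : Matrix (Fin n) (Fin n) ℂ) i j) hy
  simp only [MulMemClass.coe_mul, SetLike.val_smul, u_smul,
      Matrix.smul_apply, u_left, u_right, smul_eq_mul] at h0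
  rw [AddMemClass.coe_add, u_add, Matrix.add_apply]
  have := u_scalar_eq (hS.eigenvalues_nonneg i) (hT.eigenvalues_pos j) hl _ _ h0
  simpa [mul_assoc] using this

open MeasureTheory Real in
lemma u_integral {n : ℕ} {S T : Matrix (Fin n) (Fin n) ℂ} (hS : S.PosSemidef)
    (hT : T.PosDef) {t : ℝ} (ht : t ∈ Set.Ioo (0:ℝ) 1) (x : Matrix (Fin n) (Fin n) ℂ) :
    IntegrableOn (fun l => l ^ (t - 1) * uQ hS.1 hT.1 (fun s r => s * r / (s + l * r)) x)
      (Set.Ioi 0) ∧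
    uQ hS.1 hT.1 (fun s r => s ^ t * r ^ (1 - t)) x =
      (∫ l in Set.Ioi 0, rpowIntegrand₀₁ t l 1)⁻¹ *
      ∫ l in Set.Ioi 0, l ^ (t - 1) * uQ hS.1 hT.1 (fun s r => s * r / (s + l * r)) x := by
  let G : Fin n → Fin n → ℝ → ℝ := fun i j l =>
    (hT.1.eigenvalues j * Complex.normSq (uCo hS.1 hT.1 x i j)) *
      rpowIntegrand₀₁ t l (hS.1.eigenvalues i / hT.1.eigenvalues j)
  have hq : ∀ i j, 0 ≤ hS.1.eigenvalues i / hT.1.eigenvalues j := fun i j =>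
    div_nonneg (hS.eigenvalues_nonneg i) (hT.eigenvalues_pos j).le
  have hG : ∀ i j, IntegrableOn (G i j) (Set.Ioi 0) := fun i j =>
    (integrableOn_rpowIntegrand₀₁_Ioi ht (hq i j)).const_mul _
  have hE : Set.EqOn (fun l => ∑ i, ∑ j, G i j l)
      (fun l => l ^ (t - 1) * uQ hS.1 hT.1 (fun s r => s * r / (s + l * r)) x) (Set.Ioi 0) := by
    intro l hl
    have hl : 0 < l := hl
    simp only [uQ, Finset.mul_sum]
    refine Finset.sum_congr rfl fun i _ => Finset.sum_congr rfl fun j _ => ?_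
    simp only [G]
    rw [rpowIntegrand₀₁_eq_pow_div ht hl.le (hq i j)]
    have := hS.eigenvalues_nonneg i
    have := hT.eigenvalues_pos j
    have h1 : hS.1.eigenvalues i + l * hT.1.eigenvalues j ≠ 0 := by positivity
    have h2 : l + hS.1.eigenvalues i / hT.1.eigenvalues j ≠ 0 := by positivity
    have h3 : l + hS.1.eigenvalues i / hT.1.eigenvalues j =
      (hS.1.eigenvalues i + l * hT.1.eigenvalues j) / hT.1.eigenvalues j := by field_simp; ring
    rw [h3]
    field_simp
  have hI : ∀ i, IntegrableOn (fun l => ∑ j, G i j l) (Set.Ioi 0) := fun i =>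
    integrable_finsetSum _ fun j _ => hG i j
  refine ⟨IntegrableOn.congr_fun (integrable_finsetSum _ fun i _ => hI i) hE measurableSet_Ioi, ?_⟩
  rw [← setIntegral_congr_fun measurableSet_Ioi hE, integral_finsetSum _ fun i _ => hI i]
  simp only [uQ, Finset.mul_sum]
  refine Finset.sum_congr rfl fun i _ => ?_
  rw [integral_finsetSum _ fun j _ => hG i j, Finset.mul_sum]
  refine Finset.sum_congr rfl fun j _ => ?_
  simp only [G]
  rw [integral_const_mul]
  have h := rpow_eq_const_mul_integral ht (hq i j)
  rw [mul_left_comm, ← h, div_rpow (hS.eigenvalues_nonneg i) (hT.eigenvalues_pos j).le,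
    rpow_sub (hT.eigenvalues_pos j), rpow_one]
  ring

lemma u_star_map {n m : ℕ}
    (A₁ : StarSubalgebra ℂ (Matrix (Fin n) (Fin n) ℂ))
    (A₂ : StarSubalgebra ℂ (Matrix (Fin m) (Fin m) ℂ))
    (β : A₁ →ₗ[ℂ] A₂) (hβ1 : β 1 = 1)
    (hβS : ∀ x : A₁, ((↑(β (star x * x)) : Matrix (Fin m) (Fin m) ℂ) -
      star (↑(β x) : Matrix (Fin m) (Fin m) ℂ) * (↑(β x) : Matrix (Fin m) (Fin m) ℂ)).PosSemidef)
    (y : A₁) : (β (star y) : Matrix (Fin m) (Fin m) ℂ) =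
      star (β y : Matrix (Fin m) (Fin m) ℂ) := by
  have hsa : ∀ x : A₁, star (β (star x * x)) = β (star x * x) := by
    intro x
    apply Subtype.ext
    have h := (hβS x).1.isSelfAdjoint.add
      (IsSelfAdjoint.star_mul_self (β x : Matrix (Fin m) (Fin m) ℂ))
    rw [sub_add_cancel] at h
    exact h
  have h1 : ∀ x : A₁, star (β x) + star (β (star x)) = β x + β (star x) := by
    intro x
    have h := hsa (x + 1)
    have e : star (x + 1) * (x + 1) = star x * x + x + star x + 1 := by
      rw [star_add, star_one]; noncomm_ring
    rw [e] at h
    simp only [map_add, star_add, hβ1, star_one, hsa x] at h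
    have := add_right_cancel h
    rw [add_assoc, add_assoc] at this
    exact add_left_cancel this
  have h2 := h1 (Complex.I • y)
  have h3 := h1 y
  simp only [star_smul, map_smul, Complex.star_def, Complex.conj_I, map_neg, neg_neg] at h2
  have h4 : star (β (star y)) - star (β y) = β y - β (star y) := by
    have := congrArg (fun z => (-Complex.I) • z) h2
    simp only [smul_add, smul_smul] at this
    simp at this
    rw [sub_eq_neg_add, this, sub_eq_add_neg]
  have h5 : (2:ℂ) • star (β y) = (2:ℂ) • β (star y) := by
    rw [two_smul, two_smul]
    calc star (β y) + star (β y) = (star (β y) + star (β (star y))) -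
          (star (β (star y)) - star (β y)) := by abel
      _ = _ := by rw [h3, h4]; abel
  have h6 := smul_right_injective A₂ (two_ne_zero (α := ℂ)) h5
  rw [← h6]; rfl

/-- Uhlmann's lemma: let `β : A₁ → A₂` be a unital Schwarz map between finite-dimensional
C*-algebras (star subalgebras of matrix algebras), `S₁, T₁ ∈ A₁⁺`, `S₂, T₂ ∈ A₂⁺` with
`T₁, T₂` invertible (positive definite), and suppose `tr(S₂ β(a)) ≤ tr(S₁ a)` and
`tr(T₂ β(a)) ≤ tr(T₁ a)` for all positive `a ∈ A₁`. Then for all `0 ≤ t ≤ 1` and `x ∈ A₁`: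
`tr(β(x)* S₂^t β(x) T₂^{1-t}) ≤ tr(x* S₁^t x T₁^{1-t})`. -/
theorem uhlmann_lemma {n m : ℕ}
    (A₁ : StarSubalgebra ℂ (Matrix (Fin n) (Fin n) ℂ))
    (A₂ : StarSubalgebra ℂ (Matrix (Fin m) (Fin m) ℂ))
    (β : A₁ →ₗ[ℂ] A₂) (hβ1 : β 1 = 1)
    (hβS : ∀ x : A₁, ((↑(β (star x * x)) : Matrix (Fin m) (Fin m) ℂ) -
      star (↑(β x) : Matrix (Fin m) (Fin m) ℂ) * (↑(β x) : Matrix (Fin m) (Fin m) ℂ)).PosSemidef)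
    (S₁ T₁ : A₁) (S₂ T₂ : A₂)
    (hS₁ : (↑S₁ : Matrix (Fin n) (Fin n) ℂ).PosSemidef)
    (hT₁ : (↑T₁ : Matrix (Fin n) (Fin n) ℂ).PosDef)
    (hS₂ : (↑S₂ : Matrix (Fin m) (Fin m) ℂ).PosSemidef)
    (hT₂ : (↑T₂ : Matrix (Fin m) (Fin m) ℂ).PosDef)
    (hS : ∀ a : A₁, (↑a : Matrix (Fin n) (Fin n) ℂ).PosSemidef →
      ((↑S₂ : Matrix (Fin m) (Fin m) ℂ) * (↑(β a) : Matrix (Fin m) (Fin m) ℂ)).trace ≤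
        ((↑S₁ : Matrix (Fin n) (Fin n) ℂ) * (↑a : Matrix (Fin n) (Fin n) ℂ)).trace)
    (hT : ∀ a : A₁, (↑a : Matrix (Fin n) (Fin n) ℂ).PosSemidef →
      ((↑T₂ : Matrix (Fin m) (Fin m) ℂ) * (↑(β a) : Matrix (Fin m) (Fin m) ℂ)).trace ≤
        ((↑T₁ : Matrix (Fin n) (Fin n) ℂ) * (↑a : Matrix (Fin n) (Fin n) ℂ)).trace) :
    ∀ t : ℝ, 0 ≤ t → t ≤ 1 → ∀ x : A₁,
      (star (↑(β x) : Matrix (Fin m) (Fin m) ℂ) * hS₂.1.cfc (fun r : ℝ => r ^ t) *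
        (↑(β x) : Matrix (Fin m) (Fin m) ℂ) * (hT₂.posSemidef.1.cfc (fun r : ℝ => r ^ (1 - t)))).trace ≤
      (star (↑x : Matrix (Fin n) (Fin n) ℂ) * hS₁.1.cfc (fun r : ℝ => r ^ t) *
        (↑x : Matrix (Fin n) (Fin n) ℂ) * (hT₁.posSemidef.1.cfc (fun r : ℝ => r ^ (1 - t)))).trace := by
  have hstar : ∀ y : A₁, (β (star y) : Matrix (Fin m) (Fin m) ℂ) =
      star (β y : Matrix (Fin m) (Fin m) ℂ) := u_star_map A₁ A₂ β hβ1 hβS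
  have hSq : ∀ y : A₁, uQ hS₂.1 hT₂.1 (fun s _ => s * 1) (β y : Matrix (Fin m) (Fin m) ℂ) ≤
      uQ hS₁.1 hT₁.1 (fun s _ => s * 1) (y : Matrix (Fin n) (Fin n) ℂ) := by
    intro y
    have e2 := u_trace hS₂.1 hT₂.1 (fun s => s) (fun _ => 1) (β y : Matrix (Fin m) (Fin m) ℂ)
    have e1 := u_trace hS₁.1 hT₁.1 (fun s => s) (fun _ => 1) (y : Matrix (Fin n) (Fin n) ℂ)
    rw [u_cfc_id, u_cfc_one, mul_one] at e1 e2
    have hc := u_trace_nonneg hS₂ (hβS (star y))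
    rw [hstar, star_star, star_star, mul_sub, Matrix.trace_sub, sub_nonneg] at hc
    have hp : ((y * star y : A₁) : Matrix (Fin n) (Fin n) ℂ).PosSemidef := by
      simpa [star_eq_conjTranspose] using
        posSemidef_self_mul_conjTranspose (y : Matrix (Fin n) (Fin n) ℂ)
    have h3 := hc.trans (hS _ hp)
    have c2 : (star (β y : Matrix (Fin m) (Fin m) ℂ) * S₂ * β y).trace =
        ((S₂ : Matrix (Fin m) (Fin m) ℂ) * (β y * star (β y : Matrix (Fin m) (Fin m) ℂ))).trace := by
      rw [mul_assoc, Matrix.trace_mul_comm, mul_assoc]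
    have c1 : (star (y : Matrix (Fin n) (Fin n) ℂ) * S₁ * y).trace =
        ((S₁ : Matrix (Fin n) (Fin n) ℂ) * ((y * star y : A₁) :
          Matrix (Fin n) (Fin n) ℂ)).trace := by
      rw [mul_assoc, Matrix.trace_mul_comm, mul_assoc]; simp
    rw [← c1, ← c2, e1, e2] at h3
    exact_mod_cast h3
  have hTq : ∀ y : A₁, uQ hS₂.1 hT₂.1 (fun _ r => 1 * r) (β y : Matrix (Fin m) (Fin m) ℂ) ≤
      uQ hS₁.1 hT₁.1 (fun _ r => 1 * r) (y : Matrix (Fin n) (Fin n) ℂ) := by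
    intro y
    have e2 := u_trace hS₂.1 hT₂.1 (fun _ => 1) (fun r => r) (β y : Matrix (Fin m) (Fin m) ℂ)
    have e1 := u_trace hS₁.1 hT₁.1 (fun _ => 1) (fun r => r) (y : Matrix (Fin n) (Fin n) ℂ)
    rw [u_cfc_id, u_cfc_one, mul_one, Matrix.trace_mul_comm] at e1 e2
    have hc := u_trace_nonneg hT₂.posSemidef (hβS y)
    rw [mul_sub, Matrix.trace_sub, sub_nonneg] at hc
    have hp : ((star y * y : A₁) : Matrix (Fin n) (Fin n) ℂ).PosSemidef := by
      simpa [star_eq_conjTranspose] using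
        posSemidef_conjTranspose_mul_self (y : Matrix (Fin n) (Fin n) ℂ)
    have h3 := hc.trans (hT _ hp)
    rw [MulMemClass.coe_mul, StarMemClass.coe_star, e1, e2] at h3
    exact_mod_cast h3
  intro t ht0 ht1 x
  rw [u_trace, u_trace]
  refine Complex.real_le_real.mpr ?_
  rcases ht0.eq_or_lt with rfl | ht0
  · simpa using hTq x
  rcases ht1.eq_or_lt with rfl | ht1
  · simpa using hSq x
  have ht : t ∈ Set.Ioo (0:ℝ) 1 := ⟨ht0, ht1⟩
  obtain ⟨i2, q2⟩ := u_integral hS₂ hT₂ ht (β x : Matrix (Fin m) (Fin m) ℂ)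
  obtain ⟨i1, q1⟩ := u_integral hS₁ hT₁ ht (x : Matrix (Fin n) (Fin n) ℂ)
  rw [q1, q2]
  refine mul_le_mul_of_nonneg_left ?_
    (inv_nonneg.mpr (Real.integral_rpowIntegrand₀₁_one_pos ht).le)
  refine MeasureTheory.setIntegral_mono_on i2 i1 measurableSet_Ioi fun l hl => ?_
  have hl : 0 < l := hl
  refine mul_le_mul_of_nonneg_left ?_ (Real.rpow_nonneg hl.le _)
  obtain ⟨y, z, hx, hyz⟩ := u_decomp_eq A₁ S₁ T₁ hS₁ hT₁ hl x
  have h2 := u_decomp_le hS₂ hT₂ hl (β y : Matrix (Fin m) (Fin m) ℂ) (β z)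
  have hb : (β x : Matrix (Fin m) (Fin m) ℂ) = β y + β z := by rw [hx, map_add]; rfl
  rw [← hb] at h2
  refine le_of_mul_le_mul_left ?_ hl
  rw [hyz]
  exact h2.trans (add_le_add (hSq y) (mul_le_mul_of_nonneg_left (hTq z) hl.le))
end

section
/- Uhlmann's Monotonicity Theorem: let α_* : A → B be a trace-preserving completely positive linear map of finite-dimensional C*-algebras, and let A₁, A₂ ∈ A⁺ be density operators (positive, trace one). Then D(α_*(A₁) ‖ α_*(A₂)) ≤ D(A₁ ‖ A₂), where D(ρ‖σ) = tr(ρ(log ρ − log σ)) if supp ρ ≤ supp σ and +∞ otherwise. -/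
open Matrix
open scoped ComplexOrder

/-- The canonical embedding of a `k × k` matrix with entries in a star subalgebra
`A ⊆ M_n(ℂ)` into `M_{k·n}(ℂ)`, used to express complete positivity. -/
def toBig {n k : ℕ} {A : StarSubalgebra ℂ (Matrix (Fin n) (Fin n) ℂ)}
    (M : Matrix (Fin k) (Fin k) A) : Matrix (Fin k × Fin n) (Fin k × Fin n) ℂ :=
  fun p q => (↑(M p.1 q.1) : Matrix (Fin n) (Fin n) ℂ) p.2 q.2

/-- A linear map between finite-dimensional C*-algebras is completely positive if all
its matrix amplifications are positive. -/
def IsCompletelyPositive {n m : ℕ}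
    {A₁ : StarSubalgebra ℂ (Matrix (Fin n) (Fin n) ℂ)}
    {A₂ : StarSubalgebra ℂ (Matrix (Fin m) (Fin m) ℂ)}
    (β : A₁ →ₗ[ℂ] A₂) : Prop :=
  ∀ (k : ℕ) (M : Matrix (Fin k) (Fin k) A₁),
    (toBig M).PosSemidef → (toBig (M.map fun a => β a)).PosSemidef

open Classical in
/-- Matrix logarithm via functional calculus, taken to be `0` on the kernel
(i.e. `log` is applied to the nonzero eigenvalues only). -/
noncomputable def matLog {k : Type*} [Fintype k] [DecidableEq k]
    (ρ : Matrix k k ℂ) : Matrix k k ℂ :=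
  if h : ρ.IsHermitian then h.cfc (fun t : ℝ => if t = 0 then 0 else Real.log t) else 0

open Classical in
/-- Quantum relative entropy (divergence): `D(ρ‖σ) = tr(ρ(log ρ − log σ))` if
`supp ρ ≤ supp σ` (expressed as `ker σ ⊆ ker ρ`), and `+∞` otherwise. -/
noncomputable def qRelEnt {k : Type*} [Fintype k] [DecidableEq k]
    (ρ σ : Matrix k k ℂ) : EReal :=
  if ∀ v : k → ℂ, σ *ᵥ v = 0 → ρ *ᵥ v = 0 then
    (((ρ * (matLog ρ - matLog σ)).trace.re : ℝ) : EReal)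
  else ⊤

section Aux
open Filter Topology

theorem term_deriv (w p q : ℝ) (hp : 0 ≤ p) (hq : 0 ≤ q) (h0 : q = 0 → w * p = 0) (T : ℝ) (hT : 0 ≤ T) :
    HasDerivAt (fun T => w * p * (Real.log (q + T * p) - Real.log q)) (w * (p ^ 2 / (q + T * p))) T := by
  by_cases hz : w * p = 0
  · have : w * (p ^ 2 / (q + T * p)) = 0 := by
      rw [show w * (p ^ 2 / (q + T * p)) = (w * p) * (p / (q + T * p)) by ring, hz, zero_mul]
    rw [this]; simp only [hz, zero_mul]; exact hasDerivAt_const _ _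
  · have hq' : 0 < q := lt_of_le_of_ne hq (fun h => hz (h0 h.symm))
    have hpos : 0 < q + T * p := by positivity
    have h1 : HasDerivAt (fun T : ℝ => q + T * p) p T := by
      simpa using ((hasDerivAt_id T).mul_const p).const_add q
    have := ((h1.log hpos.ne').sub_const (Real.log q)).const_mul (w * p)
    refine this.congr_deriv ?_
    ring

theorem term_lim (w p q : ℝ) (hp : 0 ≤ p) (hq : 0 ≤ q) (h0 : q = 0 → w * p = 0) :
    Tendsto (fun T : ℝ => w * p * (Real.log (q + T * p) - Real.log q) - w * p * Real.log T) atTop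
      (𝓝 (w * p * (Real.log p - Real.log q))) := by
  by_cases hz : w * p = 0
  · simp [hz]
  · have hq' : 0 < q := lt_of_le_of_ne hq (fun h => hz (h0 h.symm))
    have hp' : 0 < p := lt_of_le_of_ne hp (fun h => hz (by rw [← h, mul_zero]))
    have h1 : Tendsto (fun T : ℝ => q / T + p) atTop (𝓝 (0 + p)) :=
      (tendsto_const_nhds.div_atTop tendsto_id).add_const p
    rw [zero_add] at h1
    have h2 := (((h1.log hp'.ne').sub_const (Real.log q)).const_mul (w * p))
    refine h2.congr' ?_
    filter_upwards [eventually_gt_atTop 0] with T hT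
    have : q / T + p = (q + T * p) / T := by field_simp
    rw [this, Real.log_div (by positivity) hT.ne']
    ring

theorem scalar_ineq {κ l : Type*} [Fintype κ] [Fintype l]
    (w p q : κ → ℝ) (w' p' q' : l → ℝ)
    (hw : ∀ i, 0 ≤ w i) (hp : ∀ i, 0 ≤ p i) (hq : ∀ i, 0 ≤ q i)
    (hw' : ∀ i, 0 ≤ w' i) (hp' : ∀ i, 0 ≤ p' i) (hq' : ∀ i, 0 ≤ q' i)
    (hs : ∑ i, w i * p i = ∑ i, w' i * p' i)
    (hG : ∀ t : ℝ, 0 < t → ∑ i, w' i * (p' i ^ 2 / (q' i + t * p' i)) ≤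
      ∑ i, w i * (p i ^ 2 / (q i + t * p i)))
    (h0 : ∀ i, q i = 0 → w i * p i = 0) :
    (∀ i, q' i = 0 → w' i * p' i = 0) ∧
    ∑ i, w' i * p' i * (Real.log (p' i) - Real.log (q' i)) ≤
      ∑ i, w i * p i * (Real.log (p i) - Real.log (q i)) := by
  have h0' : ∀ i, q' i = 0 → w' i * p' i = 0 := by
    intro i hi
    by_contra hne
    have hpi : 0 < p' i := lt_of_le_of_ne (hp' i) (fun h => hne (by rw [← h, mul_zero]))
    have hpos : 0 < w' i * p' i := lt_of_le_of_ne (mul_nonneg (hw' i) (hp' i)) (Ne.symm hne)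
    set K := ∑ i, w i * (p i ^ 2 / q i) with hK
    have hb : ∀ t : ℝ, 0 < t → w' i * p' i ≤ t * K := by
      intro t ht
      have h1 : w' i * (p' i ^ 2 / (q' i + t * p' i)) ≤
          ∑ i, w' i * (p' i ^ 2 / (q' i + t * p' i)) :=
        Finset.single_le_sum (f := fun i => w' i * (p' i ^ 2 / (q' i + t * p' i)))
          (fun j _ => by have := hw' j; have := hp' j; have := hq' j; positivity)
          (Finset.mem_univ i)
      have h2 : ∑ i, w i * (p i ^ 2 / (q i + t * p i)) ≤ K := by
        refine Finset.sum_le_sum fun j _ => ?_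
        by_cases hz : w j * p j = 0
        · rw [show w j * (p j ^ 2 / (q j + t * p j)) = (w j * p j) * (p j / (q j + t * p j)) by ring,
            show w j * (p j ^ 2 / (q j)) = (w j * p j) * (p j / (q j)) by ring, hz]
          simp
        · have hqj : 0 < q j := lt_of_le_of_ne (hq j) (fun h => hz (h0 j h.symm))
          have := hw j; have := hp j
          gcongr
          nlinarith [mul_nonneg ht.le (hp j)]
      have h3 := (h1.trans (hG t ht)).trans h2
      have h4 : w' i * (p' i ^ 2 / (q' i + t * p' i)) = w' i * p' i / t := by
        rw [hi]; field_simp; ring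
      rw [h4, div_le_iff₀ ht] at h3
      linarith
    have hK0 : 0 < K := by have := hb 1 one_pos; linarith
    have := hb (w' i * p' i / (2 * K)) (by positivity)
    have e : w' i * p' i / (2 * K) * K = w' i * p' i / 2 := by field_simp
    linarith
  refine ⟨h0', ?_⟩
  set f : ℝ → ℝ := fun T => ∑ i, w i * p i * (Real.log (q i + T * p i) - Real.log (q i)) with hf
  set f' : ℝ → ℝ := fun T => ∑ i, w' i * p' i * (Real.log (q' i + T * p' i) - Real.log (q' i)) with hf'
  have hd : ∀ T, 0 ≤ T → HasDerivAt (fun T => f T - f' T)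
      (∑ i, w i * (p i ^ 2 / (q i + T * p i)) - ∑ i, w' i * (p' i ^ 2 / (q' i + T * p' i))) T := by
    intro T hT
    refine HasDerivAt.sub ?_ ?_
    · exact HasDerivAt.fun_sum fun i _ => term_deriv _ _ _ (hp i) (hq i) (h0 i) T hT
    · exact HasDerivAt.fun_sum fun i _ => term_deriv _ _ _ (hp' i) (hq' i) (h0' i) T hT
  have hmono : MonotoneOn (fun T => f T - f' T) (Set.Ici 0) := by
    refine monotoneOn_of_deriv_nonneg (convex_Ici 0) (fun T hT => (hd T hT).continuousAt.continuousWithinAt) ?_ ?_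
    · intro T hT
      rw [interior_Ici] at hT
      exact (hd T (le_of_lt hT)).differentiableAt.differentiableWithinAt
    · intro T hT
      rw [interior_Ici] at hT
      rw [(hd T (le_of_lt hT)).deriv]
      exact sub_nonneg.2 (hG T hT)
  have hle : ∀ T, 0 ≤ T → f' T ≤ f T := by
    intro T hT
    have h := hmono (Set.mem_Ici.2 le_rfl) (Set.mem_Ici.2 hT) hT
    have e1 : f 0 = 0 := by simp [hf]
    have e2 : f' 0 = 0 := by simp [hf']
    simp only [e1, e2] at h
    linarith
  have l1 := tendsto_finsetSum Finset.univ fun i _ => term_lim (w i) _ _ (hp i) (hq i) (h0 i)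
  have l2 := tendsto_finsetSum Finset.univ fun i _ => term_lim (w' i) _ _ (hp' i) (hq' i) (h0' i)
  refine le_of_tendsto_of_tendsto l2 l1 ?_
  filter_upwards [eventually_ge_atTop 0] with T hT
  simp only [Finset.sum_sub_distrib, ← Finset.sum_mul, hs]
  have := hle T hT
  simp only [hf, hf'] at this
  linarith

theorem cp_psd {n m : ℕ} {A : StarSubalgebra ℂ (Matrix (Fin n) (Fin n) ℂ)}
    {B : StarSubalgebra ℂ (Matrix (Fin m) (Fin m) ℂ)}
    (α : A →ₗ[ℂ] B) (hα : IsCompletelyPositive α) (k : ℕ) (a : A)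
    (ha : (a : Matrix (Fin n) (Fin n) ℂ).PosSemidef) (c : Fin k → A) :
    (toBig (Matrix.of fun i j => α (star (c i) * a * c j))).PosSemidef := by
  refine hα k (Matrix.of fun i j => star (c i) * a * c j) ?_
  have := ha.conjTranspose_mul_mul_same
    (Matrix.of fun (i : Fin n) (p : Fin k × Fin n) => (c p.1 : Matrix (Fin n) (Fin n) ℂ) i p.2)
  convert this using 1
  ext ⟨i, a⟩ ⟨j, b⟩
  rfl

theorem cp_star {n m : ℕ} {A : StarSubalgebra ℂ (Matrix (Fin n) (Fin n) ℂ)}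
    {B : StarSubalgebra ℂ (Matrix (Fin m) (Fin m) ℂ)}
    (α : A →ₗ[ℂ] B) (hα : IsCompletelyPositive α) (b : A) :
    (α (star b) : Matrix (Fin m) (Fin m) ℂ) = (α b : Matrix (Fin m) (Fin m) ℂ)ᴴ := by
  have h := (cp_psd α hα 2 1 (by simpa using Matrix.PosSemidef.one) ![1, b]).isHermitian
  ext i j
  have h2 := h.apply (0, j) (1, i)
  simp [toBig] at h2
  rw [conjTranspose_apply, ← h2]
  simp

theorem cp_psd_one {n m : ℕ} {A : StarSubalgebra ℂ (Matrix (Fin n) (Fin n) ℂ)}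
    {B : StarSubalgebra ℂ (Matrix (Fin m) (Fin m) ℂ)}
    (α : A →ₗ[ℂ] B) (hα : IsCompletelyPositive α) (a : A)
    (ha : (a : Matrix (Fin n) (Fin n) ℂ).PosSemidef) :
    (α a : Matrix (Fin m) (Fin m) ℂ).PosSemidef := by
  have h := (cp_psd α hα 1 a ha ![1]).submatrix (fun i => ((0 : Fin 1), i))
  convert h using 1
  ext i j
  simp [toBig]

theorem cp_pos {n m : ℕ} {A : StarSubalgebra ℂ (Matrix (Fin n) (Fin n) ℂ)}
    {B : StarSubalgebra ℂ (Matrix (Fin m) (Fin m) ℂ)}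
    (α : A →ₗ[ℂ] B) (hα : IsCompletelyPositive α) (k : ℕ) (a : A)
    (ha : (a : Matrix (Fin n) (Fin n) ℂ).PosSemidef) (c : Fin k → A)
    (d : Fin k → Matrix (Fin m) (Fin m) ℂ) :
    0 ≤ (∑ i, ∑ j, (d i)ᴴ * (α (star (c i) * a * c j) : Matrix (Fin m) (Fin m) ℂ) * d j).trace.re := by
  have h := (cp_psd α hα k a ha c).conjTranspose_mul_mul_same
    (Matrix.of fun (p : Fin k × Fin m) (i : Fin m) => d p.1 p.2 i)
  have h2 := (Complex.le_def.1 h.trace_nonneg).1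
  have e : (∑ i, ∑ j, (d i)ᴴ * (α (star (c i) * a * c j) : Matrix (Fin m) (Fin m) ℂ) * d j) =
      (Matrix.of fun (p : Fin k × Fin m) (i : Fin m) => d p.1 p.2 i)ᴴ *
        toBig (Matrix.of fun i j => α (star (c i) * a * c j)) *
        (Matrix.of fun (p : Fin k × Fin m) (i : Fin m) => d p.1 p.2 i) := by
    ext i j
    simp only [Matrix.sum_apply, Matrix.mul_apply, Fintype.sum_prod_type, Finset.sum_mul, toBig,
      conjTranspose_apply, of_apply]
    rw [Finset.sum_comm]
    refine Finset.sum_congr rfl fun x _ => ?_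
    rw [Finset.sum_comm]
  rw [e]
  exact h2

theorem schwarz_aux {n m : ℕ} {A : StarSubalgebra ℂ (Matrix (Fin n) (Fin n) ℂ)}
    {B : StarSubalgebra ℂ (Matrix (Fin m) (Fin m) ℂ)}
    (α : A →ₗ[ℂ] B) (hα : IsCompletelyPositive α)
    (hαtr : ∀ a : A, (↑(α a) : Matrix (Fin m) (Fin m) ℂ).trace =
      (↑a : Matrix (Fin n) (Fin n) ℂ).trace)
    (x : A) (y : Matrix (Fin m) (Fin m) ℂ)
    (hx : ∀ b : A, ((α b : Matrix (Fin m) (Fin m) ℂ) * y).trace =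
      ((b : Matrix (Fin n) (Fin n) ℂ) * x).trace)
    (a : A) (ha : (a : Matrix (Fin n) (Fin n) ℂ).PosSemidef) :
    ((a : Matrix (Fin n) (Fin n) ℂ) * (x * (x : Matrix (Fin n) (Fin n) ℂ)ᴴ)).trace.re ≤
      ((α a : Matrix (Fin m) (Fin m) ℂ) * (y * yᴴ)).trace.re := by
  have h := cp_pos α hα 2 a ha ![1, x] ![y, -1]
  have hsa : star a = a := by
    ext1
    exact ha.isHermitian
  have e1 : (yᴴ * (α (a * x) : Matrix (Fin m) (Fin m) ℂ)).trace.re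
      = ((α (star x * a) : Matrix (Fin m) (Fin m) ℂ) * y).trace.re := by
    have : (a * x) = star (star x * a) := by rw [star_mul, star_star, hsa]
    rw [this, cp_star α hα, ← conjTranspose_mul, trace_conjTranspose]
    simp
  have e2 := hx (star x * a)
  have e3 := hαtr (star x * a * x)
  have e4 : (((star x * a : A) : Matrix (Fin n) (Fin n) ℂ) * x).trace =
      ((a : Matrix (Fin n) (Fin n) ℂ) * (x * (x : Matrix (Fin n) (Fin n) ℂ)ᴴ)).trace := by
    have : (((star x * a : A) : Matrix (Fin n) (Fin n) ℂ) * x) =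
      (x : Matrix (Fin n) (Fin n) ℂ)ᴴ * (a * x) := by
      rw [← mul_assoc]; rfl
    rw [this, trace_mul_comm, mul_assoc]
  have e5 : ((star x * a * x : A) : Matrix (Fin n) (Fin n) ℂ).trace =
      (((star x * a : A) : Matrix (Fin n) (Fin n) ℂ) * x).trace := rfl
  have e6 : (yᴴ * (α a : Matrix (Fin m) (Fin m) ℂ) * y).trace =
      ((α a : Matrix (Fin m) (Fin m) ℂ) * (y * yᴴ)).trace := by
    rw [mul_assoc, trace_mul_comm, mul_assoc]
  simp only [Fin.sum_univ_two, cons_val_zero, cons_val_one, star_one, one_mul, mul_one, mul_neg, neg_mul, conjTranspose_neg, conjTranspose_one,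
    trace_add, trace_neg, Complex.add_re, Complex.neg_re, neg_neg] at h
  rw [e1, e2, e3, e5, e4, e6] at h
  linarith

theorem exists_adj {n m : ℕ} {A : StarSubalgebra ℂ (Matrix (Fin n) (Fin n) ℂ)}
    {B : StarSubalgebra ℂ (Matrix (Fin m) (Fin m) ℂ)}
    (α : A →ₗ[ℂ] B) (y : Matrix (Fin m) (Fin m) ℂ) :
    ∃ x : A, ∀ b : A, ((α b : Matrix (Fin m) (Fin m) ℂ) * y).trace =
      ((b : Matrix (Fin n) (Fin n) ℂ) * x).trace := by
  let Φ : A →ₗ[ℂ] Module.Dual ℂ A := LinearMap.mk₂ ℂ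
    (fun x b : A => ((b : Matrix (Fin n) (Fin n) ℂ) * x).trace)
    (fun x x' b => by simp [mul_add]) (fun c x b => by simp)
    (fun x b b' => by simp [add_mul]) (fun c x b => by simp)
  let ψ : Module.Dual ℂ A :=
    { toFun := fun b => ((α b : Matrix (Fin m) (Fin m) ℂ) * y).trace
      map_add' := fun b b' => by simp [add_mul]
      map_smul' := fun c b => by simp }
  have : FiniteDimensional ℂ A :=
    FiniteDimensional.finiteDimensional_submodule (Subalgebra.toSubmodule A.toSubalgebra)
  have hinj : Function.Injective Φ := by
    rw [← LinearMap.ker_eq_bot, LinearMap.ker_eq_bot']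
    intro x hx
    have h : ((x : Matrix (Fin n) (Fin n) ℂ)ᴴ * x).trace = 0 := congrArg (fun f => f (star x)) hx
    rw [trace_conjTranspose_mul_self_eq_zero_iff] at h
    exact Subtype.ext h
  have hsurj : Function.Surjective Φ :=
    (LinearMap.injective_iff_surjective_of_finrank_eq_finrank Subspace.dual_finrank_eq.symm).1 hinj
  obtain ⟨x, hx⟩ := hsurj ψ
  exact ⟨x, fun b => (congrArg (fun f => f b) hx).symm⟩

theorem exists_schwarz {n m : ℕ} {A : StarSubalgebra ℂ (Matrix (Fin n) (Fin n) ℂ)}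
    {B : StarSubalgebra ℂ (Matrix (Fin m) (Fin m) ℂ)}
    (α : A →ₗ[ℂ] B) (hα : IsCompletelyPositive α)
    (hαtr : ∀ a : A, (↑(α a) : Matrix (Fin m) (Fin m) ℂ).trace =
      (↑a : Matrix (Fin n) (Fin n) ℂ).trace)
    (y : Matrix (Fin m) (Fin m) ℂ) :
    ∃ x : Matrix (Fin n) (Fin n) ℂ, ∀ a : A, (a : Matrix (Fin n) (Fin n) ℂ).PosSemidef →
      ((α a : Matrix (Fin m) (Fin m) ℂ) * y).trace.re = ((a : Matrix (Fin n) (Fin n) ℂ) * x).trace.re ∧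
      ((a : Matrix (Fin n) (Fin n) ℂ) * (x * xᴴ)).trace.re ≤
        ((α a : Matrix (Fin m) (Fin m) ℂ) * (y * yᴴ)).trace.re ∧
      ((a : Matrix (Fin n) (Fin n) ℂ) * (xᴴ * x)).trace.re ≤
        ((α a : Matrix (Fin m) (Fin m) ℂ) * (yᴴ * y)).trace.re := by
  obtain ⟨x, hx⟩ := exists_adj α y
  refine ⟨x, fun a ha => ⟨by rw [hx], schwarz_aux α hα hαtr x y hx a ha, ?_⟩⟩
  have h := schwarz_aux α hα hαtr (star x) yᴴ (fun b => ?_) a ha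
  · have e : ((star x : A) : Matrix (Fin n) (Fin n) ℂ) = (x : Matrix (Fin n) (Fin n) ℂ)ᴴ := rfl
    rwa [e, conjTranspose_conjTranspose, conjTranspose_conjTranspose] at h
  · have h1 := hx (star b)
    rw [cp_star α hα, ← trace_mul_comm, ← trace_mul_comm (x : Matrix (Fin n) (Fin n) ℂ)] at h1
    have h2 := congrArg star h1
    rw [← trace_conjTranspose, ← trace_conjTranspose, conjTranspose_mul, conjTranspose_mul,
      conjTranspose_conjTranspose] at h2
    rw [h2]
    have e : ((star b : A) : Matrix (Fin n) (Fin n) ℂ) = (b : Matrix (Fin n) (Fin n) ℂ)ᴴ := rfl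
    rw [e, conjTranspose_conjTranspose]
    rfl

theorem tr_diag3 {k : Type*} [Fintype k] [DecidableEq k] (p : k → ℝ) (W Z : Matrix k k ℂ) :
    (diagonal (fun i => (p i : ℂ)) * W * Z).trace = ∑ i, ∑ j, (p i : ℂ) * (W i j * Z j i) := by
  rw [mul_assoc, trace]
  refine Finset.sum_congr rfl fun i _ => ?_
  rw [diag_apply, diagonal_mul, Matrix.mul_apply, Finset.mul_sum]

/-- `U P Uᴴ`. -/
noncomputable def conjD {k : Type*} [Fintype k] [DecidableEq k] (U : Matrix k k ℂ) (p : k → ℝ) :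
    Matrix k k ℂ := U * diagonal (fun i => (p i : ℂ)) * Uᴴ

theorem trace_conjD {k : Type*} [Fintype k] [DecidableEq k] (U : Matrix k k ℂ) (p : k → ℝ)
    (X : Matrix k k ℂ) :
    (conjD U p * X).trace = (diagonal (fun i => (p i : ℂ)) * (Uᴴ * X) * U).trace := by
  rw [conjD, trace_mul_comm _ U]
  simp only [mul_assoc]

theorem form1 {k : Type*} [Fintype k] [DecidableEq k] (U V Z : Matrix k k ℂ) (p : k → ℝ)
    (hU : Uᴴ * U = 1) :
    (conjD U p * (V * Z * Uᴴ)).trace.re = ∑ i, ∑ j, p i * ((Uᴴ * V) i j * Z j i).re := by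
  have : diagonal (fun i => (p i : ℂ)) * (Uᴴ * (V * Z * Uᴴ)) * U =
      diagonal (fun i => (p i : ℂ)) * (Uᴴ * V) * Z := by
    simp only [mul_assoc, hU, mul_one]
  rw [trace_conjD, this, tr_diag3]
  simp

theorem form2 {k : Type*} [Fintype k] [DecidableEq k] (U V Z : Matrix k k ℂ) (q : k → ℝ)
    (hU : Uᴴ * U = 1) (hV : Vᴴ * V = 1) :
    (conjD V q * ((V * Z * Uᴴ) * (V * Z * Uᴴ)ᴴ)).trace.re =
      ∑ i, ∑ j, q j * Complex.normSq (Z j i) := by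
  have : diagonal (fun i => (q i : ℂ)) * (Vᴴ * ((V * Z * Uᴴ) * (V * Z * Uᴴ)ᴴ)) * V =
      diagonal (fun i => (q i : ℂ)) * Z * Zᴴ := by
    calc _ = diagonal (fun i => (q i : ℂ)) * ((Vᴴ * V) * Z * (Uᴴ * U) * Zᴴ * (Vᴴ * V)) := by
          simp only [conjTranspose_mul, conjTranspose_conjTranspose, mul_assoc]
      _ = _ := by simp only [hU, hV, mul_one, one_mul, mul_assoc]
  rw [trace_conjD, this, tr_diag3, Finset.sum_comm]
  simp [Complex.normSq_apply]

theorem form3 {k : Type*} [Fintype k] [DecidableEq k] (U V Z : Matrix k k ℂ) (p : k → ℝ)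
    (hU : Uᴴ * U = 1) (hV : Vᴴ * V = 1) :
    (conjD U p * ((V * Z * Uᴴ)ᴴ * (V * Z * Uᴴ))).trace.re =
      ∑ i, ∑ j, p i * Complex.normSq (Z j i) := by
  have : diagonal (fun i => (p i : ℂ)) * (Uᴴ * ((V * Z * Uᴴ)ᴴ * (V * Z * Uᴴ))) * U =
      diagonal (fun i => (p i : ℂ)) * Zᴴ * Z := by
    calc _ = diagonal (fun i => (p i : ℂ)) * ((Uᴴ * U) * Zᴴ * (Vᴴ * V) * Z * (Uᴴ * U)) := by
          simp only [conjTranspose_mul, conjTranspose_conjTranspose, mul_assoc]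
      _ = _ := by simp only [hU, hV, mul_one, one_mul, mul_assoc]
  rw [trace_conjD, this, tr_diag3]
  simp [Complex.normSq_apply]

/-- The variational functional. -/
noncomputable def vf {k : Type*} [Fintype k] (ρ σ : Matrix k k ℂ) (t : ℝ) (x : Matrix k k ℂ) : ℝ :=
  2 * (ρ * x).trace.re - (σ * (x * xᴴ)).trace.re - t * (ρ * (xᴴ * x)).trace.re

theorem vf_eq {k : Type*} [Fintype k] [DecidableEq k] (U V Z : Matrix k k ℂ) (p q : k → ℝ)
    (hU : Uᴴ * U = 1) (hV : Vᴴ * V = 1) (t : ℝ) :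
    vf (conjD U p) (conjD V q) t (V * Z * Uᴴ) = ∑ i, ∑ j,
      (2 * p i * ((Uᴴ * V) i j * Z j i).re - (q j + t * p i) * Complex.normSq (Z j i)) := by
  rw [vf, form1 _ _ _ _ hU, form2 _ _ _ _ hU hV, form3 _ _ _ _ hU hV]
  simp only [Finset.mul_sum, ← Finset.sum_sub_distrib]
  refine Finset.sum_congr rfl fun i _ => Finset.sum_congr rfl fun j _ => ?_
  ring

theorem vf_le {k : Type*} [Fintype k] [DecidableEq k] (U V x : Matrix k k ℂ) (p q : k → ℝ)
    (hU : Uᴴ * U = 1) (hV : Vᴴ * V = 1) (hp : ∀ i, 0 ≤ p i) (hq : ∀ i, 0 ≤ q i)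
    (t : ℝ) (ht : 0 < t) :
    vf (conjD U p) (conjD V q) t x ≤ ∑ i, ∑ j,
      Complex.normSq ((Uᴴ * V) i j) * (p i ^ 2 / (q j + t * p i)) := by
  have hU' : U * Uᴴ = 1 := mul_eq_one_comm.1 hU
  have hV' : V * Vᴴ = 1 := mul_eq_one_comm.1 hV
  have hx : x = V * (Vᴴ * x * U) * Uᴴ := by
    calc x = (V * Vᴴ) * x * (U * Uᴴ) := by rw [hU', hV', one_mul, mul_one]
      _ = _ := by simp only [mul_assoc]
  rw [hx, vf_eq _ _ _ _ _ hU hV]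
  refine Finset.sum_le_sum fun i _ => Finset.sum_le_sum fun j _ => ?_
  generalize (Uᴴ * V) i j = w
  generalize (Vᴴ * x * U) j i = z
  have hpi := hp i
  have hqj := hq j
  rcases hpi.eq_or_lt with h0 | h0
  · rw [← h0]
    simp only [mul_zero, zero_mul, add_zero]
    have := Complex.normSq_nonneg z
    have : 0 ≤ q j * Complex.normSq z := by positivity
    simpa using this
  · have hs : 0 < q j + t * p i := by positivity
    rw [← mul_div_assoc, le_div_iff₀ hs]
    simp only [Complex.normSq_apply, Complex.mul_re]
    generalize q j + t * p i = s at *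
    nlinarith [sq_nonneg (s * z.re - p i * w.re), sq_nonneg (s * z.im + p i * w.im)]

theorem vf_attained {k : Type*} [Fintype k] [DecidableEq k] (U V : Matrix k k ℂ) (p q : k → ℝ)
    (hU : Uᴴ * U = 1) (hV : Vᴴ * V = 1) (hp : ∀ i, 0 ≤ p i) (hq : ∀ i, 0 ≤ q i)
    (t : ℝ) (ht : 0 < t) :
    ∃ x, vf (conjD U p) (conjD V q) t x = ∑ i, ∑ j,
      Complex.normSq ((Uᴴ * V) i j) * (p i ^ 2 / (q j + t * p i)) := by
  refine ⟨V * (Matrix.of fun j i => ((p i / (q j + t * p i) : ℝ) : ℂ) * star ((Uᴴ * V) i j)) * Uᴴ, ?_⟩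
  rw [vf_eq _ _ _ _ _ hU hV]
  refine Finset.sum_congr rfl fun i _ => Finset.sum_congr rfl fun j _ => ?_
  simp only [of_apply]
  generalize (Uᴴ * V) i j = w
  have hpi := hp i
  have hqj := hq j
  rcases hpi.eq_or_lt with h0 | h0
  · rw [← h0]; simp
  · have hs : 0 < q j + t * p i := by positivity
    simp only [Complex.normSq_apply, Complex.mul_re, Complex.mul_im, Complex.ofReal_re,
      Complex.ofReal_im, Complex.star_def, Complex.conj_re, Complex.conj_im]
    generalize q j + t * p i = s at *
    field_simp
    ring

theorem ker_iff {k : Type*} [Fintype k] [DecidableEq k] (U V : Matrix k k ℂ) (p q : k → ℝ)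
    (hU : Uᴴ * U = 1) (hV : Vᴴ * V = 1) :
    (∀ v : k → ℂ, conjD V q *ᵥ v = 0 → conjD U p *ᵥ v = 0) ↔
      ∀ i j, q j = 0 → Complex.normSq ((Uᴴ * V) i j) * p i = 0 := by
  have hV' : V * Vᴴ = 1 := mul_eq_one_comm.1 hV
  constructor
  · intro h i j hj
    have h1 : conjD V q *ᵥ (V *ᵥ Pi.single j 1) = 0 := by
      rw [mulVec_mulVec, conjD, mul_assoc, hV, mul_one, ← mulVec_mulVec]
      have : diagonal (fun i => (q i : ℂ)) *ᵥ Pi.single j 1 = 0 := by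
        ext l
        rw [mulVec_diagonal]
        by_cases hl : l = j
        · subst hl; simp [hj]
        · simp [hl]
      rw [this, mulVec_zero]
    have h2 := congrArg (fun v => Uᴴ *ᵥ v) (h _ h1)
    simp only [mulVec_zero, mulVec_mulVec, conjD] at h2
    rw [show Uᴴ * (U * diagonal (fun i => (p i : ℂ)) * Uᴴ * V) =
      (Uᴴ * U) * (diagonal (fun i => (p i : ℂ)) * (Uᴴ * V)) by simp only [mul_assoc], hU, one_mul] at h2
    have h3 := congrFun h2 i
    simp only [mulVec_single_one, col_apply, diagonal_mul, Pi.zero_apply] at h3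
    rcases mul_eq_zero.1 h3 with h4 | h4
    · have : p i = 0 := by exact_mod_cast h4
      rw [this, mul_zero]
    · rw [h4]; simp
  · intro h v hv
    have h1 := congrArg (fun v => Vᴴ *ᵥ v) hv
    simp only [mulVec_zero, mulVec_mulVec, conjD] at h1
    rw [show Vᴴ * (V * diagonal (fun i => (q i : ℂ)) * Vᴴ) =
      (Vᴴ * V) * (diagonal (fun i => (q i : ℂ)) * Vᴴ) by simp only [mul_assoc], hV, one_mul,
      ← mulVec_mulVec] at h1
    have e : conjD U p = U * ((diagonal (fun i => (p i : ℂ)) * (Uᴴ * V)) * Vᴴ) := by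
      rw [conjD]
      calc _ = U * diagonal (fun i => (p i : ℂ)) * (Uᴴ * (V * Vᴴ)) := by rw [hV', mul_one]
        _ = _ := by simp only [mul_assoc]
    rw [e, ← mulVec_mulVec, ← mulVec_mulVec]
    have : (diagonal (fun i => (p i : ℂ)) * (Uᴴ * V)) *ᵥ (Vᴴ *ᵥ v) = 0 := by
      generalize Vᴴ *ᵥ v = u at *
      ext i
      rw [mulVec, dotProduct]
      refine Finset.sum_eq_zero fun j _ => ?_
      have h2 := congrFun h1 j
      rw [mulVec_diagonal] at h2
      rcases mul_eq_zero.1 h2 with h4 | h4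
      · have h5 := h i j (by exact_mod_cast h4)
        rw [diagonal_mul]
        rcases mul_eq_zero.1 h5 with h6 | h6
        · rw [Complex.normSq_eq_zero.1 h6]; simp
        · rw [h6]; simp
      · rw [h4, mul_zero]
    rw [this, mulVec_zero]

theorem row_sum {k : Type*} [Fintype k] [DecidableEq k] (U V : Matrix k k ℂ)
    (hU : Uᴴ * U = 1) (hV : Vᴴ * V = 1) (i : k) :
    ∑ j, Complex.normSq ((Uᴴ * V) i j) = 1 := by
  have hV' : V * Vᴴ = 1 := mul_eq_one_comm.1 hV
  have h : (Uᴴ * V) * (Uᴴ * V)ᴴ = 1 := by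
    calc _ = Uᴴ * (V * Vᴴ) * U := by
          simp only [conjTranspose_mul, conjTranspose_conjTranspose, mul_assoc]
      _ = 1 := by rw [hV', mul_one, hU]
  have h2 := congrFun (congrFun h i) i
  rw [Matrix.mul_apply, one_apply_eq] at h2
  simp only [conjTranspose_apply, Complex.star_def, Complex.mul_conj] at h2
  exact_mod_cast h2

theorem trace_conjD_one {k : Type*} [Fintype k] [DecidableEq k] (U : Matrix k k ℂ) (p : k → ℝ)
    (hU : Uᴴ * U = 1) : (conjD U p).trace.re = ∑ i, p i := by
  rw [conjD, trace_mul_comm, ← mul_assoc, hU, one_mul]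
  simp [trace]

theorem trace_mul_conjD {k : Type*} [Fintype k] [DecidableEq k] (U V : Matrix k k ℂ) (p q : k → ℝ) :
    (conjD U p * conjD V q).trace.re = ∑ i, ∑ j, Complex.normSq ((Uᴴ * V) i j) * p i * q j := by
  have : diagonal (fun i => (p i : ℂ)) * (Uᴴ * conjD V q) * U =
      diagonal (fun i => (p i : ℂ)) * (Uᴴ * V) * (diagonal (fun i => (q i : ℂ)) * (Uᴴ * V)ᴴ) := by
    simp only [conjD, conjTranspose_mul, conjTranspose_conjTranspose, mul_assoc]
  rw [trace_conjD, this, tr_diag3, Complex.re_sum]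
  refine Finset.sum_congr rfl fun i _ => ?_
  rw [Complex.re_sum]
  refine Finset.sum_congr rfl fun j _ => ?_
  rw [diagonal_mul, conjTranspose_apply]
  generalize (Uᴴ * V) i j = w
  simp only [Complex.normSq_apply, Complex.mul_re, Complex.mul_im, Complex.ofReal_re,
      Complex.ofReal_im, Complex.star_def, Complex.conj_re, Complex.conj_im]
  ring

theorem relEnt_formula {k : Type*} [Fintype k] [DecidableEq k] (U V : Matrix k k ℂ) (p q : k → ℝ)
    (hU : Uᴴ * U = 1) (hV : Vᴴ * V = 1) :
    (conjD U p * (conjD U (fun i => Real.log (p i)) - conjD V (fun i => Real.log (q i)))).trace.re =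
      ∑ i, ∑ j, Complex.normSq ((Uᴴ * V) i j) * p i * (Real.log (p i) - Real.log (q j)) := by
  rw [mul_sub, trace_sub, Complex.sub_re, trace_mul_conjD, trace_mul_conjD, ← Finset.sum_sub_distrib]
  refine Finset.sum_congr rfl fun i _ => ?_
  simp only [mul_sub, Finset.sum_sub_distrib]
  congr 1
  rw [hU]
  simp only [mul_assoc, ← Finset.sum_mul, row_sum U V hU hV i]
  rw [Finset.sum_eq_single i]
  · simp
  · intro j _ hj; simp [one_apply_ne (Ne.symm hj)]
  · simp

theorem spectral_data {k : Type*} [Fintype k] [DecidableEq k] (ρ : Matrix k k ℂ)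
    (h : ρ.PosSemidef) : ∃ (U : Matrix k k ℂ) (p : k → ℝ), Uᴴ * U = 1 ∧ (∀ i, 0 ≤ p i) ∧
      ρ = conjD U p ∧ matLog ρ = conjD U (fun i => Real.log (p i)) := by
  refine ⟨h.isHermitian.eigenvectorUnitary, h.isHermitian.eigenvalues, ?_, h.eigenvalues_nonneg, ?_, ?_⟩
  · exact Unitary.coe_star_mul_self _
  · exact h.isHermitian.spectral_theorem
  · rw [matLog, dif_pos h.isHermitian, IsHermitian.cfc, Unitary.conjStarAlgAut_apply, conjD]
    congr 3
    ext i
    simp only [Function.comp_apply]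
    split_ifs with h0
    · simp [h0]
    · rfl

end Aux

theorem uhlmann_monotonicity {n m : ℕ}
    (A : StarSubalgebra ℂ (Matrix (Fin n) (Fin n) ℂ))
    (B : StarSubalgebra ℂ (Matrix (Fin m) (Fin m) ℂ))
    (α : A →ₗ[ℂ] B) (hαcp : IsCompletelyPositive α)
    (hαtr : ∀ a : A, (↑(α a) : Matrix (Fin m) (Fin m) ℂ).trace =
      (↑a : Matrix (Fin n) (Fin n) ℂ).trace)
    (ρ₁ ρ₂ : A)
    (hρ₁ : (↑ρ₁ : Matrix (Fin n) (Fin n) ℂ).PosSemidef)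
    (hρ₂ : (↑ρ₂ : Matrix (Fin n) (Fin n) ℂ).PosSemidef)
    (hρ₁t : (↑ρ₁ : Matrix (Fin n) (Fin n) ℂ).trace = 1)
    (hρ₂t : (↑ρ₂ : Matrix (Fin n) (Fin n) ℂ).trace = 1) :
    qRelEnt (↑(α ρ₁) : Matrix (Fin m) (Fin m) ℂ) (↑(α ρ₂) : Matrix (Fin m) (Fin m) ℂ) ≤
      qRelEnt (↑ρ₁ : Matrix (Fin n) (Fin n) ℂ) (↑ρ₂ : Matrix (Fin n) (Fin n) ℂ) := by
  by_cases hker : ∀ v : Fin n → ℂ, (ρ₂ : Matrix (Fin n) (Fin n) ℂ) *ᵥ v = 0 →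
    (ρ₁ : Matrix (Fin n) (Fin n) ℂ) *ᵥ v = 0
  swap
  · rw [qRelEnt, qRelEnt, if_neg hker]
    exact le_top
  have hvf : ∀ t : ℝ, 0 < t → ∀ y, ∃ x, vf (α ρ₁ : Matrix (Fin m) (Fin m) ℂ) (α ρ₂) t y ≤
      vf (ρ₁ : Matrix (Fin n) (Fin n) ℂ) ρ₂ t x := by
    intro t ht y
    obtain ⟨x, hx⟩ := exists_schwarz α hαcp hαtr y
    refine ⟨x, ?_⟩
    obtain ⟨h1, -, h3⟩ := hx ρ₁ hρ₁
    obtain ⟨-, h5, -⟩ := hx ρ₂ hρ₂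
    have := mul_le_mul_of_nonneg_left h3 ht.le
    rw [vf, vf, h1]
    linarith
  have htr := hαtr ρ₁
  obtain ⟨U, p, hU, hp, e1, l1⟩ := spectral_data _ hρ₁
  obtain ⟨V, q, hV, hq, e2, l2⟩ := spectral_data _ hρ₂
  obtain ⟨U', p', hU', hp', e1', l1'⟩ := spectral_data _ (cp_psd_one α hαcp ρ₁ hρ₁)
  obtain ⟨V', q', hV', hq', e2', l2'⟩ := spectral_data _ (cp_psd_one α hαcp ρ₂ hρ₂)
  have hs : ∀ {k : ℕ} (U V : Matrix (Fin k) (Fin k) ℂ) (p : Fin k → ℝ), Uᴴ * U = 1 → Vᴴ * V = 1 →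
      ∑ ij : Fin k × Fin k, Complex.normSq ((Uᴴ * V) ij.1 ij.2) * p ij.1 = (conjD U p).trace.re := by
    intro k U V p hU hV
    rw [trace_conjD_one U p hU, Fintype.sum_prod_type]
    refine Finset.sum_congr rfl fun i _ => ?_
    simp only [← Finset.sum_mul, row_sum U V hU hV i, one_mul]
  have key := scalar_ineq
    (fun ij : Fin n × Fin n => Complex.normSq ((Uᴴ * V) ij.1 ij.2)) (fun ij => p ij.1) (fun ij => q ij.2)
    (fun ij : Fin m × Fin m => Complex.normSq ((U'ᴴ * V') ij.1 ij.2)) (fun ij => p' ij.1) (fun ij => q' ij.2)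
    (fun _ => Complex.normSq_nonneg _) (fun _ => hp _) (fun _ => hq _)
    (fun _ => Complex.normSq_nonneg _) (fun _ => hp' _) (fun _ => hq' _)
    (by rw [hs U V p hU hV, hs U' V' p' hU' hV', ← e1, ← e1', htr])
    (by
      intro t ht
      obtain ⟨y, hy⟩ := vf_attained U' V' p' q' hU' hV' hp' hq' t ht
      obtain ⟨x, hx⟩ := hvf t ht y
      rw [Fintype.sum_prod_type, Fintype.sum_prod_type, ← hy, ← e1', ← e2']
      refine hx.trans ?_
      rw [e1, e2]
      exact vf_le U V x p q hU hV hp hq t ht)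
    (by
      rw [e1, e2, ker_iff U V p q hU hV] at hker
      exact fun ij h => hker ij.1 ij.2 h)
  obtain ⟨k1, k2⟩ := key
  have hker' : ∀ v : Fin m → ℂ, (α ρ₂ : Matrix (Fin m) (Fin m) ℂ) *ᵥ v = 0 →
      (α ρ₁ : Matrix (Fin m) (Fin m) ℂ) *ᵥ v = 0 := by
    rw [e1', e2', ker_iff U' V' p' q' hU' hV']
    exact fun i j h => k1 (i, j) h
  rw [qRelEnt, qRelEnt, if_pos hker, if_pos hker', EReal.coe_le_coe_iff, l1, l2, l1', l2',
    e1, e1', relEnt_formula U V p q hU hV, relEnt_formula U' V' p' q' hU' hV']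
  rw [Fintype.sum_prod_type, Fintype.sum_prod_type] at k2
  exact k2
end
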